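/- For every positive integer n, the set L₁ of block-diagonal 2n×2n matrices can be reduced to L₁ ∩ Σ in weak L^{2n}, and the set L₂ of block anti-diagonal 2n×2n matrices can be reduced to L₂ ∩ Σ in weak L^{2n}. -/

import Mathlib

open MeasureTheory Set Filter Topology

noncomputable section

namespace Paper

variable {ι κ : Type*}

/-- Frobenius (Hilbert–Schmidt) norm of a matrix. -/
def frobNorm [Fintype ι] [Fintype κ] (A : Matrix κ ι ℝ) : ℝ :=
  Real.sqrt (∑ k, ∑ i, (A k i) ^ 2)

/-- Frobenius distance from a matrix to a set of matrices. -/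
def frobDist [Fintype ι] [Fintype κ] (X : Matrix κ ι ℝ) (S : Set (Matrix κ ι ℝ)) : ℝ :=
  sInf ((fun Y => frobNorm (X - Y)) '' S)

/-- The affine map `x ↦ A x + b`. -/
def lmap [Fintype ι] (A : Matrix κ ι ℝ) (b : κ → ℝ) (x : ι → ℝ) : κ → ℝ :=
  fun k => (∑ i, A k i * x i) + b k

/-- A regular domain: open, bounded, connected, with Lebesgue-null boundary. -/
def IsRegularDomain [Fintype ι] (Ω : Set (ι → ℝ)) : Prop :=
  IsOpen Ω ∧ Bornology.IsBounded Ω ∧ IsConnected Ω ∧ volume (frontier Ω) = 0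

/-- `u` agrees with an affine map on `S`. -/
def IsAffineOn [Fintype ι] (u : (ι → ℝ) → κ → ℝ) (S : Set (ι → ℝ)) : Prop :=
  ∃ (B : Matrix κ ι ℝ) (c : κ → ℝ), ∀ x ∈ S, u x = lmap B c x

/-- `u` is piecewise affine on `Ω`. -/
def IsPiecewiseAffineOn [Fintype ι] (u : (ι → ℝ) → κ → ℝ) (Ω : Set (ι → ℝ)) : Prop :=
  ∃ 𝒮 : Set (Set (ι → ℝ)), 𝒮.Countable ∧
    (∀ V ∈ 𝒮, IsRegularDomain V ∧ V ⊆ Ω ∧ IsAffineOn u V) ∧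
    𝒮.PairwiseDisjoint id ∧ volume (Ω \ ⋃₀ 𝒮) = 0

/-- `G` is the weak (distributional) gradient of `u` on `Ω`, and `u ∈ W^{1,1}(Ω)`. -/
structure HasWeakGradientOn [Fintype ι] [DecidableEq ι] [Fintype κ]
    (u : (ι → ℝ) → κ → ℝ) (G : (ι → ℝ) → Matrix κ ι ℝ) (Ω : Set (ι → ℝ)) : Prop where
  integrable : IntegrableOn u Ω volume
  integrable_grad : ∀ (k : κ) (i : ι), IntegrableOn (fun x => G x k i) Ω volume
  parts : ∀ φ : (ι → ℝ) → ℝ, (∀ n : ℕ, ContDiff ℝ n φ) → HasCompactSupport φ →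
    tsupport φ ⊆ Ω → ∀ (k : κ) (i : ι),
      ∫ x in Ω, u x k * fderiv ℝ φ x (Pi.single i 1) = - ∫ x in Ω, G x k i * φ x

/-- Membership in `C^α(S)`: continuous on `S` and (for `α > 0`) `α`-Hölder on `S`. -/
def MemHolder [Fintype ι] [Fintype κ] (α : ℝ) (S : Set (ι → ℝ)) (u : (ι → ℝ) → κ → ℝ) : Prop :=
  ContinuousOn u S ∧ ∃ C : ℝ, ∀ x ∈ S, ∀ y ∈ S, dist (u x) (u y) ≤ C * dist x y ^ α

/-- The `C^α` norm on `S`. -/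
def holderNorm [Fintype ι] [Fintype κ] (α : ℝ) (S : Set (ι → ℝ)) (u : (ι → ℝ) → κ → ℝ) : ℝ :=
  sSup ((fun x => ‖u x‖) '' S) +
    sSup {r : ℝ | ∃ x ∈ S, ∃ y ∈ S, x ≠ y ∧ r = dist (u x) (u y) / dist x y ^ α}

/-- `K` can be reduced to `K'` in weak `L^p`, with constant `M`. -/
def ReducesWith [Fintype ι] [DecidableEq ι] [Fintype κ] (M : ℝ)
    (K K' : Set (Matrix κ ι ℝ)) (p : ℝ) : Prop :=
  ∀ A ∈ K, ∀ b : κ → ℝ, ∀ ε ∈ Set.Ioo (0:ℝ) 1, ∀ α ∈ Set.Ioo (0:ℝ) 1, ∀ s ∈ Set.Ioi (1:ℝ),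
    ∀ Ω : Set (ι → ℝ), IsRegularDomain Ω →
      ∃ (u : (ι → ℝ) → κ → ℝ) (G : (ι → ℝ) → Matrix κ ι ℝ),
        IsPiecewiseAffineOn u Ω ∧ HasWeakGradientOn u G Ω ∧ MemHolder α (closure Ω) u ∧
        (∀ x ∈ frontier Ω, u x = lmap A b x) ∧
        (∫ x in {x ∈ Ω | G x ∉ K'}, (1 + frobNorm (G x)) ^ s) < ε * (volume Ω).toReal ∧
        ∀ t : ℝ, 0 < t →
          volume {x ∈ Ω | t < frobNorm (G x)}
            ≤ ENNReal.ofReal (M ^ p * (1 + frobNorm A ^ p) * t ^ (-p)) * volume Ω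

/-- `K` can be reduced to `K'` in weak `L^p`. -/
def ReducedTo [Fintype ι] [DecidableEq ι] [Fintype κ]
    (K K' : Set (Matrix κ ι ℝ)) (p : ℝ) : Prop :=
  ∃ M : ℝ, 1 ≤ M ∧ ReducesWith M K K' p

/-- Block-diagonal `2n×2n` matrices (w.r.t. the splitting `ℝ^{2n} = ℝ^n × ℝ^n`). -/
def L1set (n : ℕ) : Set (Matrix (Fin n ⊕ Fin n) (Fin n ⊕ Fin n) ℝ) :=
  {X | (∀ i j, X (Sum.inl i) (Sum.inr j) = 0) ∧ (∀ i j, X (Sum.inr i) (Sum.inl j) = 0)}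

/-- Block anti-diagonal `2n×2n` matrices. -/
def L2set (n : ℕ) : Set (Matrix (Fin n ⊕ Fin n) (Fin n ⊕ Fin n) ℝ) :=
  {X | (∀ i j, X (Sum.inl i) (Sum.inl j) = 0) ∧ (∀ i j, X (Sum.inr i) (Sum.inr j) = 0)}

/-- Split matrices `L = L₁ ∪ L₂`. -/
def LSet (n : ℕ) : Set (Matrix (Fin n ⊕ Fin n) (Fin n ⊕ Fin n) ℝ) := L1set n ∪ L2set n

/-- Matrices of determinant one. -/
def SigmaSet (n : ℕ) : Set (Matrix (Fin n ⊕ Fin n) (Fin n ⊕ Fin n) ℝ) := {X | X.det = 1}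


/-- Value at `x` of the affine functional with linear part `g.1` and constant part `g.2`. -/
def affEval [Fintype ι] (g : (ι → ℝ) × ℝ) (x : ι → ℝ) : ℝ := (∑ i, g.1 i * x i) + g.2

/-- Bounded finite intersections of open half-spaces. -/
def IsPolytope [Fintype ι] (V : Set (ι → ℝ)) : Prop :=
  Bornology.IsBounded V ∧ ∃ F : Finset ((ι → ℝ) × ℝ), V = {x | ∀ g ∈ F, 0 < affEval g x}

section AffEval

variable [Fintype ι]

theorem continuous_affEval (g : (ι → ℝ) × ℝ) : Continuous (affEval g) := by
  unfold affEval; fun_prop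

theorem affEval_sub (g h : (ι → ℝ) × ℝ) (x : ι → ℝ) :
    affEval (g - h) x = affEval g x - affEval h x := by
  simp only [affEval, Prod.fst_sub, Prod.snd_sub, Pi.sub_apply, sub_mul, Finset.sum_sub_distrib]
  ring

theorem affEval_smul (c : ℝ) (g : (ι → ℝ) × ℝ) (x : ι → ℝ) :
    affEval (c • g) x = c * affEval g x := by
  simp only [affEval, Prod.smul_fst, Prod.smul_snd, Pi.smul_apply, smul_eq_mul, mul_add,
    Finset.mul_sum, mul_assoc]

theorem affEval_single [DecidableEq ι] (i : ι) (c d : ℝ) (x : ι → ℝ) :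
    affEval (Pi.single i c, d) x = c * x i + d := by
  simp [affEval, Pi.single_apply]

theorem affEval_sub_affEval (g : (ι → ℝ) × ℝ) (x y : ι → ℝ) :
    affEval g x - affEval g y = ∑ i, g.1 i * (x i - y i) := by
  simp [affEval, mul_sub, Finset.sum_sub_distrib]

theorem abs_affEval_sub_le (g : (ι → ℝ) × ℝ) (x y : ι → ℝ) :
    |affEval g x - affEval g y| ≤ (∑ i, |g.1 i|) * dist x y := by
  rw [affEval_sub_affEval, Finset.sum_mul]
  refine (Finset.abs_sum_le_sum_abs _ _).trans (Finset.sum_le_sum fun i _ => ?_)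
  rw [abs_mul, ← Real.dist_eq]
  exact mul_le_mul_of_nonneg_left (dist_le_pi_dist x y i) (abs_nonneg _)

theorem hasFDerivAt_affEval (g : (ι → ℝ) × ℝ) (x : ι → ℝ) :
    HasFDerivAt (affEval g) (∑ i, g.1 i • ContinuousLinearMap.proj (R := ℝ) (φ := fun _ : ι => ℝ) i)
      x := by
  unfold affEval
  refine HasFDerivAt.add_const _ (HasFDerivAt.fun_sum fun i _ => ?_)
  exact (hasFDerivAt_apply i x).const_mul (g.1 i)

theorem affEval_segment (g : (ι → ℝ) × ℝ) (x y : ι → ℝ) {a b : ℝ} (hab : a + b = 1) :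
    affEval g (a • x + b • y) = a * affEval g x + b * affEval g y := by
  have hb : b = 1 - a := by linarith
  subst hb
  simp only [affEval, Pi.add_apply, Pi.smul_apply, smul_eq_mul, mul_add, Finset.mul_sum,
    Finset.sum_add_distrib]
  have h1 : ∑ i, g.1 i * (a * x i) = ∑ i, a * (g.1 i * x i) :=
    Finset.sum_congr rfl fun i _ => by ring
  have h2 : ∑ i, g.1 i * ((1 - a) * y i) = ∑ i, (1 - a) * (g.1 i * y i) :=
    Finset.sum_congr rfl fun i _ => by ring
  rw [h1, h2]; ring

theorem volume_affEval_eq_zero (g : (ι → ℝ) × ℝ) (hg : g ≠ 0) :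
    volume {x | affEval g x = 0} = 0 := by
  classical
  let S : AffineSubspace ℝ (ι → ℝ) :=
    { carrier := {x | affEval g x = 0}
      smul_vsub_vadd_mem' := by
        intro c p₁ p₂ p₃ h₁ h₂ h₃
        simp only [mem_ofPred_eq] at *
        have e1 := affEval_sub_affEval g p₁ p₂
        have e2 := affEval_sub_affEval g (c • (p₁ -ᵥ p₂) +ᵥ p₃) p₃
        have e3 : ∑ i, g.1 i * ((c • (p₁ -ᵥ p₂) +ᵥ p₃) i - p₃ i)
            = c * ∑ i, g.1 i * (p₁ i - p₂ i) := by
          rw [Finset.mul_sum]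
          refine Finset.sum_congr rfl fun i _ => ?_
          simp; ring
        rw [e3, ← e1, h₁, h₂, h₃] at e2
        simpa using e2 }
  refine Measure.addHaar_affineSubspace volume S fun htop => hg ?_
  have hall : ∀ x, affEval g x = 0 := fun x => by
    have : x ∈ S := by rw [htop]; trivial
    exact this
  have h2 : g.2 = 0 := by simpa [affEval] using hall 0
  have h1 : g.1 = 0 := by
    funext i
    have := hall (Pi.single i 1)
    simpa [affEval, h2, Pi.single_apply] using this
  exact Prod.ext h1 h2

theorem IsPolytope.isOpen {V : Set (ι → ℝ)} (hV : IsPolytope V) : IsOpen V := by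
  obtain ⟨-, F, rfl⟩ := hV
  have : {x : ι → ℝ | ∀ g ∈ F, 0 < affEval g x} = ⋂ g ∈ F, {x | 0 < affEval g x} := by
    ext; simp
  rw [this]
  exact isOpen_biInter_finset fun g _ => isOpen_lt continuous_const (continuous_affEval g)

theorem IsPolytope.convex {V : Set (ι → ℝ)} (hV : IsPolytope V) : Convex ℝ V := by
  obtain ⟨-, F, rfl⟩ := hV
  intro x hx y hy a b ha hb hab g hg
  rw [affEval_segment g x y hab]
  have h1 := hx g hg
  have h2 := hy g hg
  rcases ha.eq_or_lt with rfl | ha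
  · have : b = 1 := by linarith
    subst this; simpa using h2
  · positivity

theorem IsPolytope.volume_frontier {V : Set (ι → ℝ)} (hV : IsPolytope V) :
    volume (frontier V) = 0 := hV.convex.addHaar_frontier volume

theorem IsPolytope.volume_lt_top {V : Set (ι → ℝ)} (hV : IsPolytope V) :
    volume V < ⊤ := hV.1.measure_lt_top

theorem IsPolytope.isRegularDomain {V : Set (ι → ℝ)} (hV : IsPolytope V) (hne : V.Nonempty) :
    IsRegularDomain V :=
  ⟨hV.isOpen, hV.1, ⟨hne, hV.convex.isPreconnected⟩, hV.volume_frontier⟩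

theorem isPolytope_ball (c : ι → ℝ) (r : ℝ) (hr : 0 < r) : IsPolytope (Metric.ball c r) := by
  classical
  refine ⟨Metric.isBounded_ball, (Finset.univ.image fun i => (Pi.single i 1, r - c i)) ∪
    (Finset.univ.image fun i => (Pi.single i (-1), r + c i)), ?_⟩
  ext x
  simp only [Metric.mem_ball, dist_pi_lt_iff hr, Real.dist_eq, abs_lt, Finset.mem_union,
    Finset.mem_image, Finset.mem_univ, true_and, mem_ofPred_eq]
  constructor
  · rintro h g (⟨i, rfl⟩ | ⟨i, rfl⟩)
    · rw [affEval_single]; have := h i; linarith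
    · rw [affEval_single]; have := h i; linarith
  · intro h i
    have h1 := h _ (Or.inl ⟨i, rfl⟩)
    have h2 := h _ (Or.inr ⟨i, rfl⟩)
    rw [affEval_single] at h1 h2
    constructor <;> linarith

end AffEval

section Tent

variable [Fintype ι]

/-- The tent `max 0 (min_{g ∈ F} g)`. -/
def tent (F : Finset ((ι → ℝ) × ℝ)) (hF : F.Nonempty) (x : ι → ℝ) : ℝ :=
  max 0 (F.inf' hF fun g => affEval g x)

/-- The region where `g` is positive and the strict minimum of the functionals in `F`. -/
def tentCell (F : Finset ((ι → ℝ) × ℝ)) (g : (ι → ℝ) × ℝ) : Set (ι → ℝ) :=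
  {x | 0 < affEval g x ∧ ∀ h ∈ F, h ≠ g → affEval g x < affEval h x}

variable {F : Finset ((ι → ℝ) × ℝ)} (hF : F.Nonempty)

theorem abs_tent_sub_le {C : ℝ} (hC : ∀ g ∈ F, ∑ i, |g.1 i| ≤ C) (x y : ι → ℝ) :
    |tent F hF x - tent F hF y| ≤ C * dist x y := by
  have key : ∀ x y : ι → ℝ, (F.inf' hF fun g => affEval g x) ≤
      (F.inf' hF fun g => affEval g y) + C * dist x y := by
    intro x y
    obtain ⟨g, hg, he⟩ := Finset.exists_mem_eq_inf' hF fun g => affEval g y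
    rw [he]
    refine (Finset.inf'_le _ hg).trans ?_
    have h1 := abs_affEval_sub_le g x y
    have h2 := mul_le_mul_of_nonneg_right (hC g hg) (dist_nonneg (x := x) (y := y))
    have h3 := le_abs_self (affEval g x - affEval g y)
    linarith
  refine (abs_max_sub_max_le_max _ _ _ _).trans ?_
  rw [sub_self, abs_zero]
  refine max_le ?_ ?_
  · obtain ⟨g, hg⟩ := hF
    have : 0 ≤ C := (Finset.sum_nonneg fun i _ => abs_nonneg _).trans (hC g hg)
    positivity
  · rw [abs_le]
    have h1 := key x y
    have h2 := key y x
    rw [dist_comm y x] at h2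
    constructor <;> linarith

theorem tent_nonneg (x : ι → ℝ) : 0 ≤ tent F hF x := le_max_left _ _

theorem tent_eq_zero {g : (ι → ℝ) × ℝ} (hg : g ∈ F) {x : ι → ℝ} (hx : affEval g x ≤ 0) :
    tent F hF x = 0 :=
  max_eq_left ((Finset.inf'_le _ hg).trans hx)

theorem tent_le {g : (ι → ℝ) × ℝ} (hg : g ∈ F) {x : ι → ℝ} :
    tent F hF x ≤ max 0 (affEval g x) :=
  max_le_max le_rfl (Finset.inf'_le _ hg)

theorem tent_eq_of_mem_tentCell {g : (ι → ℝ) × ℝ} (hg : g ∈ F) {x : ι → ℝ}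
    (hx : x ∈ tentCell F g) : tent F hF x = affEval g x := by
  have : (F.inf' hF fun g => affEval g x) = affEval g x := by
    refine le_antisymm (Finset.inf'_le _ hg) (Finset.le_inf' _ _ fun h hh => ?_)
    by_cases e : h = g
    · rw [e]
    · exact (hx.2 h hh e).le
  rw [tent, this, max_eq_right hx.1.le]

theorem tentCell_pos {g : (ι → ℝ) × ℝ} {x : ι → ℝ} (hx : x ∈ tentCell F g) :
    ∀ h ∈ F, 0 < affEval h x := fun h hh => by
  by_cases e : h = g
  · rw [e]; exact hx.1
  · exact hx.1.trans (hx.2 h hh e)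

theorem isPolytope_tentCell {g : (ι → ℝ) × ℝ} (hb : Bornology.IsBounded (tentCell F g)) :
    IsPolytope (tentCell F g) := by
  classical
  refine ⟨hb, insert g ((F.erase g).image fun h => h - g), ?_⟩
  ext x
  simp only [tentCell, mem_ofPred_eq, Finset.mem_insert, Finset.mem_image, Finset.mem_erase]
  constructor
  · rintro ⟨h1, h2⟩ k (rfl | ⟨h, ⟨hne, hh⟩, rfl⟩)
    · exact h1
    · rw [affEval_sub]; exact sub_pos.2 (h2 h hh hne)
  · intro H
    refine ⟨H g (Or.inl rfl), fun h hh hne => ?_⟩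
    have := H (h - g) (Or.inr ⟨h, ⟨hne, hh⟩, rfl⟩)
    rw [affEval_sub] at this
    exact sub_pos.1 this

theorem disjoint_tentCell {g g' : (ι → ℝ) × ℝ} (hg : g ∈ F) (hg' : g' ∈ F) (hne : g ≠ g') :
    Disjoint (tentCell F g) (tentCell F g') := by
  rw [Set.disjoint_left]
  intro x hx hx'
  exact lt_asymm (hx.2 g' hg' hne.symm) (hx'.2 g hg hne)

theorem exists_mem_tentCell (hF : F.Nonempty) {x : ι → ℝ} (hx : ∀ g ∈ F, 0 < affEval g x)
    (hne : ∀ g ∈ F, ∀ h ∈ F, g ≠ h → affEval (g - h) x ≠ 0) : ∃ g ∈ F, x ∈ tentCell F g := by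
  obtain ⟨g, hg, he⟩ := Finset.exists_mem_eq_inf' hF fun g => affEval g x
  refine ⟨g, hg, hx g hg, fun h hh hhg => lt_of_le_of_ne ?_ fun e => ?_⟩
  · have : (F.inf' hF fun g => affEval g x) ≤ affEval h x := Finset.inf'_le _ hh
    rwa [he] at this
  · exact hne g hg h hh hhg.symm (by rw [affEval_sub, e, sub_self])

end Tent

theorem exists_glue {I X F : Type*} [Zero F] (S : I → Set X)
    (hS : ∀ i j x, x ∈ S i → x ∈ S j → i = j) (w : I → X → F) :
    ∃ W : X → F, (∀ i, ∀ x ∈ S i, W x = w i x) ∧ ∀ x, (∀ i, x ∉ S i) → W x = 0 := by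
  classical
  refine ⟨fun x => if h : ∃ i, x ∈ S i then w h.choose x else 0, fun i x hx => ?_, fun x hx => ?_⟩
  · have h : ∃ i, x ∈ S i := ⟨i, hx⟩
    simp only [dif_pos h]
    rw [hS _ _ x h.choose_spec hx]
  · have h : ¬ ∃ i, x ∈ S i := fun ⟨i, hi⟩ => hx i hi
    simp only [dif_neg h]

/-- `h` is the weak gradient of the integrable function `f` on the whole space. -/
structure IsWeakGrad [Fintype ι] [DecidableEq ι] (f : (ι → ℝ) → ℝ) (h : (ι → ℝ) → ι → ℝ) :
    Prop where
  integrable : Integrable f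
  integrable_grad : ∀ l, Integrable fun x => h x l
  parts : ∀ φ : (ι → ℝ) → ℝ, (∀ n : ℕ, ContDiff ℝ n φ) → HasCompactSupport φ → ∀ l,
    ∫ x, f x * fderiv ℝ φ x (Pi.single l 1) = - ∫ x, h x l * φ x

section

variable [Fintype ι] [DecidableEq ι]

theorem isWeakGrad_of_lipschitz {f : (ι → ℝ) → ℝ} {h : (ι → ℝ) → ι → ℝ} {V : Set (ι → ℝ)}
    (hV : IsPolytope V) {L : ℝ} (hL : ∀ x y, |f x - f y| ≤ L * dist x y)
    (hfV : ∀ x ∉ V, f x = 0) (hhV : ∀ x ∉ V, h x = 0) {𝒬 : Set (Set (ι → ℝ))}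
    (hP : ∀ W ∈ 𝒬, IsOpen W ∧ ∃ g, ∀ x ∈ W, f x = affEval g x ∧ h x = g.1)
    (hcov : volume (V \ ⋃₀ 𝒬) = 0) : IsWeakGrad f h := by
  have hlip : LipschitzWith L.toNNReal f := LipschitzWith.of_dist_le_mul fun x y => by
    rw [Real.dist_eq]
    refine (hL x y).trans (mul_le_mul_of_nonneg_right ?_ dist_nonneg)
    exact Real.le_coe_toNNReal L
  have hae : ∀ l, (fun x => h x l) =ᵐ[volume] fun x => lineDeriv ℝ f x (Pi.single l 1) := by
    intro l
    have h1 : ∀ᵐ x : ι → ℝ, x ∉ V \ ⋃₀ 𝒬 := measure_eq_zero_iff_ae_notMem.1 hcov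
    have h2 : ∀ᵐ x : ι → ℝ, x ∉ frontier V := measure_eq_zero_iff_ae_notMem.1 hV.volume_frontier
    filter_upwards [h1, h2] with x hx1 hx2
    by_cases hxV : x ∈ V
    · have hxP : x ∈ ⋃₀ 𝒬 := by by_contra hc; exact hx1 ⟨hxV, hc⟩
      obtain ⟨W, hW, hxW⟩ := hxP
      obtain ⟨hWo, g, hg⟩ := hP W hW
      have hf : HasFDerivAt f _ x := (hasFDerivAt_affEval g x).congr_of_eventuallyEq <| by
        filter_upwards [hWo.mem_nhds hxW] with y hy using (hg y hy).1
      rw [(hf.hasLineDerivAt (Pi.single l 1)).lineDeriv, (hg x hxW).2]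
      simp [Pi.single_apply]
    · have hxc : x ∉ closure V := fun hc => hx2 ⟨hc, fun hi => hxV (interior_subset hi)⟩
      have hf : HasFDerivAt f (0 : (ι → ℝ) →L[ℝ] ℝ) x :=
        (hasFDerivAt_const (0 : ℝ) x).congr_of_eventuallyEq <| by
          filter_upwards [isClosed_closure.isOpen_compl.mem_nhds hxc] with y hy using
            hfV y fun hc => hy (subset_closure hc)
      rw [(hf.hasLineDerivAt (Pi.single l 1)).lineDeriv, hhV x hxV]
      simp
  have hVfin := hV.volume_lt_top
  refine ⟨?_, fun l => ?_, fun φ hφ hφc l => ?_⟩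
  · rw [← integrableOn_iff_integrable_of_support_subset (s := closure V) (f := f)]
    · exact hlip.continuous.continuousOn.integrableOn_compact
        (Metric.isCompact_of_isClosed_isBounded isClosed_closure hV.1.closure)
    · intro x hx
      by_contra hc
      exact hx (hfV x fun h => hc (subset_closure h))
  · rw [← integrableOn_iff_integrable_of_support_subset (s := V)]
    · refine Measure.integrableOn_of_bounded (M := L.toNNReal * ‖(Pi.single l 1 : ι → ℝ)‖) hVfin.ne
        ((measurable_lineDeriv (𝕜 := ℝ) hlip.continuous).aestronglyMeasurable.congr (hae l).symm) ?_
      filter_upwards [ae_restrict_of_ae (hae l)] with x hx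
      rw [hx]
      exact norm_lineDeriv_le_of_lipschitz ℝ hlip
    · intro x hx
      by_contra hc
      exact hx (by simp [hhV x hc])
  · obtain ⟨D, hD⟩ := (hφ 1).lipschitzWith_of_hasCompactSupport hφc (by simp)
    have key := LipschitzWith.integral_lineDeriv_mul_eq (μ := volume) hlip hD hφc (Pi.single l 1)
    have e1 : ∫ x, h x l * φ x = ∫ x, lineDeriv ℝ f x (Pi.single l 1) * φ x :=
      integral_congr_ae (by filter_upwards [hae l] with x hx; rw [hx])
    rw [e1, key, ← integral_neg]
    congr 1
    funext x
    have hd : DifferentiableAt ℝ φ x := (hφ 1).differentiable (by simp) x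
    rw [hd.lineDeriv_eq_fderiv, map_neg]
    ring

theorem IsWeakGrad.integral_eq_zero {f : (ι → ℝ) → ℝ} {h : (ι → ℝ) → ι → ℝ} {V : Set (ι → ℝ)}
    (hw : IsWeakGrad f h) (hV : Bornology.IsBounded V) (hfV : ∀ x ∉ V, f x = 0)
    (hhV : ∀ x ∉ V, h x = 0) (l : ι) : ∫ x, h x l = 0 := by
  obtain ⟨r, hr⟩ := hV.subset_ball (0 : ι → ℝ)
  let φ : ContDiffBump (0 : ι → ℝ) := ⟨max r 1, max r 1 + 1, by positivity, by linarith⟩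
  have hφ1 : ∀ x ∈ V, φ =ᶠ[𝓝 x] 1 := fun x hx =>
    φ.eventuallyEq_one_of_mem_ball (Metric.ball_subset_ball (le_max_left _ _) (hr hx))
  have key := hw.parts φ (fun n => φ.contDiff) φ.hasCompactSupport l
  have e1 : ∀ x, f x * fderiv ℝ φ x (Pi.single l 1) = 0 := fun x => by
    by_cases hx : x ∈ V
    · rw [(hφ1 x hx).fderiv_eq]
      simp
    · rw [hfV x hx, zero_mul]
  have e2 : ∀ x, h x l * φ x = h x l := fun x => by
    by_cases hx : x ∈ V
    · rw [(hφ1 x hx).eq_of_nhds]; simp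
    · rw [hhV x hx]; simp
  simp only [e1, e2, integral_zero] at key
  linarith

end

/-- A small Lipschitz function is Hölder with a small constant. -/
theorem exists_holder_threshold {L θ α : ℝ} (hL : 0 < L) (hθ : 0 < θ) (hα : α ∈ Ioo (0 : ℝ) 1) :
    ∃ σ > 0, ∀ {X : Type _} [PseudoMetricSpace X] (f : X → ℝ), (∀ x, |f x| ≤ σ) →
      (∀ x y, |f x - f y| ≤ L * dist x y) → ∀ x y, |f x - f y| ≤ θ * dist x y ^ α := by
  obtain ⟨hα0, hα1⟩ := hα
  set δ : ℝ := (θ / L) ^ (1 / (1 - α)) with hδ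
  have hδ0 : 0 < δ := by positivity
  have h1α : 0 < 1 - α := by linarith
  have hδp : δ ^ (1 - α) = θ / L := by
    rw [hδ, ← Real.rpow_mul (by positivity), one_div, inv_mul_cancel₀ h1α.ne', Real.rpow_one]
  refine ⟨θ * δ ^ α / 2, by positivity, fun {X} _ f hf hlip x y => ?_⟩
  rcases le_or_gt (dist x y) δ with hd | hd
  · rcases (dist_nonneg (x := x) (y := y)).eq_or_lt with h0 | h0
    · have := hlip x y
      rw [← h0] at this ⊢
      rw [Real.zero_rpow hα0.ne']
      simpa using this
    · refine (hlip x y).trans ?_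
      have e : dist x y = dist x y ^ (1 - α) * dist x y ^ α := by
        rw [← Real.rpow_add h0]; simp
      have h2 : dist x y ^ (1 - α) ≤ θ / L := by
        rw [← hδp]; exact Real.rpow_le_rpow h0.le hd h1α.le
      calc L * dist x y = L * dist x y ^ (1 - α) * dist x y ^ α := by rw [mul_assoc, ← e]
        _ ≤ L * (θ / L) * dist x y ^ α := by gcongr
        _ = θ * dist x y ^ α := by field_simp
  · have h1 : |f x - f y| ≤ θ * δ ^ α := by
      refine (abs_sub _ _).trans ?_
      linarith [hf x, hf y]
    refine h1.trans ?_
    gcongr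

/-- A small piecewise affine function on `V`, vanishing off `V`, whose gradient is `l₁ eᵢ` or
`-l₂ eᵢ` on most of `V` and small elsewhere. -/
structure IsSawtooth [Fintype ι] [DecidableEq ι] (V : Set (ι → ℝ)) (i : ι) (l₁ l₂ θ α : ℝ)
    (f : (ι → ℝ) → ℝ) (h : (ι → ℝ) → ι → ℝ) (𝒬 : Set (Set (ι → ℝ))) : Prop where
  countable : 𝒬.Countable
  piece : ∀ W ∈ 𝒬, IsPolytope W ∧ W ⊆ V ∧ ∃ g, ∀ x ∈ W, f x = affEval g x ∧ h x = g.1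
  disj : 𝒬.PairwiseDisjoint id
  cover : volume (V \ ⋃₀ 𝒬) = 0
  zero : ∀ x ∉ V, f x = 0
  grad_zero : ∀ x ∉ ⋃₀ 𝒬, h x = 0
  small : ∀ x, |f x| ≤ θ
  holder : ∀ x y, |f x - f y| ≤ θ * dist x y ^ α
  weak : IsWeakGrad f h
  vals : ∀ x, h x = Pi.single i l₁ ∨ h x = Pi.single i (-l₂) ∨ ∀ l, |h x l| ≤ θ
  err : volume {x ∈ ⋃₀ 𝒬 | h x ≠ Pi.single i l₁ ∧ h x ≠ Pi.single i (-l₂)} ≤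
    ENNReal.ofReal θ * volume V
  up : (l₁ + l₂) * (volume {x ∈ ⋃₀ 𝒬 | h x = Pi.single i l₁}).toReal ≤
    (l₂ + θ) * (volume V).toReal

section

variable [Fintype ι]

/-- A bounded finite intersection of half-spaces can be defined by functionals of arbitrarily
small slope, and is then filled up by its points where all functionals are not too small. -/
theorem IsPolytope.exists_small_functionals {V : Set (ι → ℝ)} (hV : IsPolytope V) {θ : ℝ}
    (hθ : 0 < θ) : ∃ F : Finset ((ι → ℝ) × ℝ), V = {x | ∀ g ∈ F, 0 < affEval g x} ∧
      (∀ g ∈ F, ∑ i, |g.1 i| ≤ θ) ∧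
      ∃ τ > 0, volume {x ∈ V | ∃ g ∈ F, affEval g x ≤ τ} ≤ ENNReal.ofReal θ * volume V := by
  classical
  obtain ⟨F₀, hF₀⟩ := hV.2
  obtain ⟨C, hC⟩ : ∃ C : ℝ, ∀ g ∈ F₀, ∑ i, |g.1 i| ≤ C := by
    obtain ⟨C, hC⟩ := (F₀.image fun g => ∑ i, |g.1 i|).exists_le
    exact ⟨C, fun g hg => hC _ (Finset.mem_image_of_mem _ hg)⟩
  set c : ℝ := θ / (|C| + 1) with hc
  have hc0 : 0 < c := by positivity
  refine ⟨F₀.image fun g => c • g, ?_, ?_, ?_⟩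
  · rw [hF₀]
    ext x
    simp only [mem_ofPred_eq, Finset.forall_mem_image, affEval_smul]
    exact forall₂_congr fun g _ => (mul_pos_iff_of_pos_left hc0).symm
  · simp only [Finset.forall_mem_image]
    intro g hg
    have : ∑ i, |(c • g).1 i| = c * ∑ i, |g.1 i| := by
      simp [Finset.mul_sum, abs_mul, abs_of_pos hc0]
    rw [this, hc, div_mul_eq_mul_div, div_le_iff₀ (by positivity)]
    have := hC g hg
    have := le_abs_self C
    exact mul_le_mul_of_nonneg_left (by linarith) hθ.le
  · set F := F₀.image fun g => c • g with hF
    have hVF : ∀ x ∈ V, ∀ g ∈ F, 0 < affEval g x := by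
      intro x hx
      rw [hF₀] at hx
      simp only [hF, Finset.forall_mem_image, affEval_smul]
      exact fun g hg => mul_pos hc0 (hx g hg)
    rcases V.eq_empty_or_nonempty with rfl | hne
    · exact ⟨1, one_pos, by simp⟩
    let s : ℕ → Set (ι → ℝ) := fun n => {x ∈ V | ∃ g ∈ F, affEval g x ≤ 1 / (n + 1 : ℝ)}
    have hmeas : ∀ n, MeasurableSet (s n) := fun n => by
      have : s n = V ∩ ⋃ g ∈ F, {x | affEval g x ≤ 1 / (n + 1 : ℝ)} := by
        ext x; simp [s]
      rw [this]
      refine hV.isOpen.measurableSet.inter (Finset.measurableSet_biUnion _ fun g _ => ?_)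
      exact (isClosed_le (continuous_affEval g) continuous_const).measurableSet
    have hanti : Antitone s := fun m n hmn x ⟨hx, g, hg, hgx⟩ =>
      ⟨hx, g, hg, hgx.trans (Nat.one_div_le_one_div hmn)⟩
    have hempty : ⋂ n, s n = ∅ := by
      refine eq_empty_of_forall_notMem fun x hx => ?_
      rw [mem_iInter] at hx
      have hxV : x ∈ V := (hx 0).1
      have hFne : F.Nonempty := let ⟨_, g, hg, _⟩ := hx 0; ⟨g, hg⟩
      have hpos : 0 < F.inf' hFne fun g => affEval g x :=
        (Finset.lt_inf'_iff _).2 fun g hg => hVF x hxV g hg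
      obtain ⟨n, hn⟩ := exists_nat_one_div_lt hpos
      obtain ⟨-, g, hg, hgx⟩ := hx n
      have := Finset.inf'_le (fun g => affEval g x) hg
      linarith
    have ht := tendsto_measure_iInter_atTop (μ := volume) (fun n => (hmeas n).nullMeasurableSet)
      hanti ⟨0, ((measure_mono fun x hx => hx.1).trans_lt hV.volume_lt_top).ne⟩
    rw [hempty, measure_empty] at ht
    have hpos : 0 < ENNReal.ofReal θ * volume V :=
      ENNReal.mul_pos (by simpa using hθ) (hV.isOpen.measure_pos volume hne).ne'
    obtain ⟨n, hn⟩ := ((tendsto_order.1 ht).2 _ hpos).exists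
    exact ⟨1 / (n + 1), by positivity, hn.le⟩

variable [DecidableEq ι]

theorem sum_abs_single (i : ι) (c : ℝ) : ∑ l, |(Pi.single i c : ι → ℝ) l| = |c| := by
  rw [Finset.sum_eq_single i] <;> simp +contextual

theorem exists_isSawtooth {V : Set (ι → ℝ)} (hV : IsPolytope V) (i : ι) {l₁ l₂ θ α : ℝ}
    (h₁ : 0 < l₁) (h₂ : 0 < l₂) (hθ : 0 < θ) (hα : α ∈ Ioo (0 : ℝ) 1) :
    ∃ f h 𝒬, IsSawtooth V i l₁ l₂ θ α f h 𝒬 := by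
  obtain ⟨F, hF, hFθ, τ₁, hτ₁, hFτ⟩ := hV.exists_small_functionals hθ
  set L : ℝ := l₁ + l₂ + θ with hL
  obtain ⟨σ, hσ, hhold⟩ := exists_holder_threshold (L := 2 * L) (θ := θ) (by positivity) hθ hα
  set τ : ℝ := min τ₁ (min σ θ) / (l₁ + l₂) with hτ
  have hm : 0 < min τ₁ (min σ θ) := by positivity
  have hτ0 : 0 < τ := by positivity
  have hlτ : (l₁ + l₂) * τ = min τ₁ (min σ θ) := by rw [hτ]; field_simp
  let a : ℤ → (ι → ℝ) × ℝ := fun k => (Pi.single i l₁, -(l₁ * (k * τ)))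
  let b : ℤ → (ι → ℝ) × ℝ := fun k => (Pi.single i (-l₂), l₂ * ((k + 1) * τ))
  let Fk : ℤ → Finset ((ι → ℝ) × ℝ) := fun k => insert (a k) (insert (b k) F)
  have ha : ∀ k, a k ∈ Fk k := fun k => by simp [Fk]
  have hb : ∀ k, b k ∈ Fk k := fun k => by simp [Fk]
  have hFk : ∀ k, ∀ g ∈ F, g ∈ Fk k := fun k g hg => by simp [Fk, hg]
  have hne : ∀ k, (Fk k).Nonempty := fun k => ⟨_, ha k⟩
  have eva : ∀ k x, affEval (a k) x = l₁ * (x i - k * τ) := fun k x => by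
    simp only [a, affEval_single]; ring
  have evb : ∀ k x, affEval (b k) x = l₂ * ((k + 1) * τ - x i) := fun k x => by
    simp only [b, affEval_single]; ring
  have hslope : ∀ k, ∀ g ∈ Fk k, ∑ l, |g.1 l| ≤ L := by
    intro k g hg
    simp only [Fk, Finset.mem_insert] at hg
    rcases hg with rfl | rfl | hg
    · simp only [a, sum_abs_single, abs_of_pos h₁]; linarith
    · simp only [b, sum_abs_single, abs_neg, abs_of_pos h₂]; linarith
    · have := hFθ g hg; linarith
  -- localisation in slabs
  have hslab : ∀ (k : ℤ) (x : ι → ℝ), 0 < affEval (a k) x → 0 < affEval (b k) x →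
      ⌊x i / τ⌋ = k := by
    intro k x hax hbx
    rw [eva] at hax
    rw [evb] at hbx
    have h1 := (mul_pos_iff_of_pos_left h₁).1 hax
    have h2 := (mul_pos_iff_of_pos_left h₂).1 hbx
    rw [Int.floor_eq_iff, le_div_iff₀ hτ0, div_lt_iff₀ hτ0]
    constructor <;> linarith
  have htent0 : ∀ (k : ℤ) (x : ι → ℝ), ⌊x i / τ⌋ ≠ k → tent (Fk k) (hne k) x = 0 := by
    intro k x hk
    by_cases hax : 0 < affEval (a k) x
    · by_cases hbx : 0 < affEval (b k) x
      · exact absurd (hslab k x hax hbx) hk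
      · exact tent_eq_zero _ (hb k) (not_lt.1 hbx)
    · exact tent_eq_zero _ (ha k) (not_lt.1 hax)
  let f : (ι → ℝ) → ℝ := fun x => tent (Fk ⌊x i / τ⌋) (hne _) x
  -- cells
  have hcellV : ∀ k, ∀ g, tentCell (Fk k) g ⊆ V := fun k g x hx => by
    rw [hF]; exact fun h hh => tentCell_pos hx h (hFk k h hh)
  have hcellfl : ∀ k g, ∀ x ∈ tentCell (Fk k) g, ⌊x i / τ⌋ = k := fun k g x hx =>
    hslab k x (tentCell_pos hx _ (ha k)) (tentCell_pos hx _ (hb k))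
  have hcelldisj : ∀ p q : {p : ℤ × ((ι → ℝ) × ℝ) // p.2 ∈ Fk p.1}, ∀ x,
      x ∈ tentCell (Fk p.1.1) p.1.2 → x ∈ tentCell (Fk q.1.1) q.1.2 → p = q := by
    rintro ⟨⟨k, g⟩, hg⟩ ⟨⟨k', g'⟩, hg'⟩ x hx hx'
    have e : k = k' := (hcellfl k g x hx).symm.trans (hcellfl k' g' x hx')
    subst e
    by_cases e : g = g'
    · subst e; rfl
    · exact absurd hx' (Set.disjoint_left.1 (disjoint_tentCell hg hg' e) hx)
  obtain ⟨h, hh, hh0⟩ := exists_glue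
    (fun p : {p : ℤ × ((ι → ℝ) × ℝ) // p.2 ∈ Fk p.1} => tentCell (Fk p.1.1) p.1.2) hcelldisj
    (fun p _ => p.1.2.1)
  let 𝒬 : Set (Set (ι → ℝ)) :=
    range fun p : {p : ℤ × ((ι → ℝ) × ℝ) // p.2 ∈ Fk p.1} => tentCell (Fk p.1.1) p.1.2
  have hmem𝒬 : ∀ x, x ∈ ⋃₀ 𝒬 → ∃ k g, g ∈ Fk k ∧ x ∈ tentCell (Fk k) g ∧ h x = g.1 := by
    rintro x ⟨_, ⟨⟨⟨k, g⟩, hg⟩, rfl⟩, hx⟩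
    exact ⟨k, g, hg, hx, hh ⟨⟨k, g⟩, hg⟩ x hx⟩
  have hcount : 𝒬.Countable := by
    have : 𝒬 ⊆ ⋃ k : ℤ, (fun g => tentCell (Fk k) g) '' (Fk k : Set ((ι → ℝ) × ℝ)) := by
      rintro _ ⟨⟨⟨k, g⟩, hg⟩, rfl⟩
      exact mem_iUnion.2 ⟨k, g, hg, rfl⟩
    exact (countable_iUnion fun k => ((Fk k).countable_toSet.image _)).mono this
  have hpiece : ∀ W ∈ 𝒬, IsPolytope W ∧ W ⊆ V ∧ ∃ g, ∀ x ∈ W, f x = affEval g x ∧ h x = g.1 := by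
    rintro _ ⟨⟨⟨k, g⟩, hg⟩, rfl⟩
    refine ⟨isPolytope_tentCell (hV.1.subset (hcellV k g)), hcellV k g, g, fun x hx => ⟨?_, ?_⟩⟩
    · have e := hcellfl k g x hx
      simp only [f, e]
      exact tent_eq_of_mem_tentCell (hne k) hg hx
    · exact hh ⟨⟨k, g⟩, hg⟩ x hx
  have hdisj : 𝒬.PairwiseDisjoint id := by
    rintro _ ⟨p, rfl⟩ _ ⟨q, rfl⟩ hpq
    refine Set.disjoint_left.2 fun x hx hx' => hpq ?_
    rw [hcelldisj p q x hx hx']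
  have hcover : volume (V \ ⋃₀ 𝒬) = 0 := by
    have hsub : V \ ⋃₀ 𝒬 ⊆ (⋃ k : ℤ, {x | affEval (a k) x = 0}) ∪
        ⋃ k : ℤ, ⋃ g ∈ Fk k, ⋃ g' ∈ Fk k, ⋃ _ : g ≠ g', {x | affEval (g - g') x = 0} := by
      rintro x ⟨hxV, hxQ⟩
      by_contra hc
      rw [mem_union, not_or] at hc
      simp only [mem_iUnion, not_exists, mem_ofPred_eq] at hc
      set k := ⌊x i / τ⌋ with hk
      have hk1 : k * τ ≤ x i := by rw [← le_div_iff₀ hτ0]; exact Int.floor_le _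
      have hk2 : x i < (k + 1) * τ := by rw [← div_lt_iff₀ hτ0]; exact Int.lt_floor_add_one _
      have hpos : ∀ g ∈ Fk k, 0 < affEval g x := by
        intro g hg
        simp only [Fk, Finset.mem_insert] at hg
        rcases hg with rfl | rfl | hg
        · refine lt_of_le_of_ne ?_ (Ne.symm (hc.1 k))
          rw [eva]; exact mul_nonneg h₁.le (by linarith)
        · rw [evb]; exact mul_pos h₂ (by linarith)
        · rw [hF] at hxV; exact hxV g hg
      obtain ⟨g, hg, hxg⟩ := exists_mem_tentCell (hne k) hpos fun g hg g' hg' hgg' =>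
        hc.2 k g hg g' hg' hgg'
      exact hxQ ⟨_, ⟨⟨⟨k, g⟩, hg⟩, rfl⟩, hxg⟩
    refine measure_mono_null hsub (measure_union_null ?_ ?_)
    · refine measure_iUnion_null fun k => volume_affEval_eq_zero _ fun e => ?_
      have := congrFun (congrArg Prod.fst e) i
      simp [a, h₁.ne'] at this
    · refine measure_iUnion_null fun k => ?_
      refine (measure_biUnion_null_iff (Fk k).countable_toSet).2 fun g _ => ?_
      refine (measure_biUnion_null_iff (Fk k).countable_toSet).2 fun g' _ => ?_
      exact measure_iUnion_null fun e => volume_affEval_eq_zero _ (sub_ne_zero.2 e)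
  have hzero : ∀ x ∉ V, f x = 0 := by
    intro x hx
    rw [hF] at hx
    simp only [mem_ofPred_eq, not_forall, not_lt] at hx
    obtain ⟨g, hg, hgx⟩ := hx
    exact tent_eq_zero _ (hFk _ g hg) hgx
  have hgz : ∀ x ∉ ⋃₀ 𝒬, h x = 0 := fun x hx => hh0 x fun p hp => hx ⟨_, ⟨p, rfl⟩, hp⟩
  have hsmall : ∀ x, |f x| ≤ (l₁ + l₂) * τ := by
    intro x
    rw [abs_of_nonneg (tent_nonneg _ _)]
    refine (tent_le _ (ha _)).trans (max_le (by positivity) ?_)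
    have hk2 : x i < (⌊x i / τ⌋ + 1) * τ := by
      rw [← div_lt_iff₀ hτ0]; exact Int.lt_floor_add_one _
    rw [eva]
    have : l₁ * (x i - ⌊x i / τ⌋ * τ) ≤ l₁ * τ := mul_le_mul_of_nonneg_left (by linarith) h₁.le
    nlinarith
  have hlip : ∀ x y, |f x - f y| ≤ 2 * L * dist x y := by
    intro x y
    have hL0 : 0 ≤ L * dist x y := by positivity
    have hx := abs_tent_sub_le (hne ⌊x i / τ⌋) (hslope _) x y
    have hy := abs_tent_sub_le (hne ⌊y i / τ⌋) (hslope _) x y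
    by_cases e : ⌊x i / τ⌋ = ⌊y i / τ⌋
    · have : f y = tent (Fk ⌊x i / τ⌋) (hne _) y := by simp only [f, e]
      rw [this]
      linarith
    · rw [htent0 _ y (Ne.symm e), sub_zero] at hx
      rw [htent0 _ x e, zero_sub, abs_neg] at hy
      have := abs_sub (f x) (f y)
      simp only [f] at this ⊢
      linarith
  have hweak : IsWeakGrad f h := by
    refine isWeakGrad_of_lipschitz (𝒬 := 𝒬) hV hlip hzero
      (fun x hx => hgz x fun ⟨W, hW, hxW⟩ => hx ((hpiece W hW).2.1 hxW))
      (fun W hW => ⟨(hpiece W hW).1.isOpen, (hpiece W hW).2.2⟩) hcover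
  have hvals : ∀ x, h x = Pi.single i l₁ ∨ h x = Pi.single i (-l₂) ∨ ∀ l, |h x l| ≤ θ := by
    intro x
    by_cases hx : x ∈ ⋃₀ 𝒬
    · obtain ⟨k, g, hg, hxg, e⟩ := hmem𝒬 x hx
      simp only [Fk, Finset.mem_insert] at hg
      rcases hg with rfl | rfl | hg
      · exact Or.inl e
      · exact Or.inr (Or.inl e)
      · refine Or.inr (Or.inr fun l => ?_)
        rw [e]
        exact (Finset.single_le_sum (f := fun l => |g.1 l|) (fun l _ => abs_nonneg _)
          (Finset.mem_univ l)).trans (hFθ g hg)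
    · refine Or.inr (Or.inr fun l => ?_)
      rw [hgz x hx]; simpa using hθ.le
  have hVtop := hV.volume_lt_top.ne
  have hQV : ⋃₀ 𝒬 ⊆ V := sUnion_subset fun W hW => (hpiece W hW).2.1
  refine ⟨f, h, 𝒬, hcount, hpiece, hdisj, hcover, hzero, hgz, fun x => (hsmall x).trans ?_,
    hhold f (fun x => (hsmall x).trans ?_) hlip, hweak, hvals, ?_, ?_⟩
  · rw [hlτ]; exact (min_le_right _ _).trans (min_le_right _ _)
  · rw [hlτ]; exact (min_le_right _ _).trans (min_le_left _ _)
  · refine (measure_mono ?_).trans hFτ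
    rintro x ⟨hxQ, hx1, hx2⟩
    refine ⟨hQV hxQ, ?_⟩
    obtain ⟨k, g, hg, hxg, e⟩ := hmem𝒬 x hxQ
    have hgF : g ∈ F := by
      simp only [Fk, Finset.mem_insert] at hg
      rcases hg with rfl | rfl | hg
      · exact absurd e hx1
      · exact absurd e hx2
      · exact hg
    refine ⟨g, hgF, ?_⟩
    have hfx : f x = affEval g x := by
      have e' := hcellfl k g x hxg
      simp only [f, e']
      exact tent_eq_of_mem_tentCell (hne k) (hFk k g hgF) hxg
    rw [← hfx]
    refine (le_abs_self _).trans ((hsmall x).trans ?_)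
    rw [hlτ]; exact min_le_left _ _
  · have hinteg := hweak.integral_eq_zero hV.1 hzero
      (fun x hx => hgz x fun hc => hx (hQV hc)) i
    set U := {x ∈ ⋃₀ 𝒬 | h x = Pi.single i l₁} with hU
    have hUm : MeasurableSet U := by
      have : U = ⋃ W ∈ {W ∈ 𝒬 | ∀ x ∈ W, h x = Pi.single i l₁}, W := by
        ext x
        simp only [hU, mem_iUnion, exists_prop, mem_ofPred_eq]
        constructor
        · rintro ⟨⟨W, hW, hxW⟩, hx⟩
          refine ⟨W, ⟨hW, fun y hy => ?_⟩, hxW⟩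
          obtain ⟨g, hg⟩ := (hpiece W hW).2.2
          rw [(hg y hy).2, ← (hg x hxW).2, hx]
        · rintro ⟨W, ⟨hW, hW'⟩, hxW⟩
          exact ⟨⟨W, hW, hxW⟩, hW' x hxW⟩
      rw [this]
      exact MeasurableSet.biUnion (hcount.mono fun W hW => hW.1) fun W hW =>
        (hpiece W hW.1).1.isOpen.measurableSet
    have hUV : U ⊆ V := fun x hx => hQV hx.1
    have hUtop : volume U ≠ ⊤ := (measure_mono hUV).trans_lt hV.volume_lt_top |>.ne
    have hi1 : Integrable (U.indicator fun _ => l₁ + l₂) :=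
      (integrable_indicator_iff hUm).2 (integrableOn_const hUtop)
    have hi2 : Integrable (V.indicator fun _ => l₂ + θ) :=
      (integrable_indicator_iff hV.isOpen.measurableSet).2 (integrableOn_const hVtop)
    have hle : ∫ x, (U.indicator (fun _ => l₁ + l₂) x - V.indicator (fun _ => l₂ + θ) x) ≤
        ∫ x, h x i := by
      refine integral_mono (hi1.sub hi2) (hweak.integrable_grad i) fun x => ?_
      simp only
      by_cases hxV : x ∈ V
      · rw [indicator_of_mem hxV]
        by_cases hxU : x ∈ U
        · rw [indicator_of_mem hxU, hxU.2, Pi.single_eq_same]; linarith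
        · rw [indicator_of_notMem hxU]
          rcases hvals x with e | e | e
          · by_cases hxQ : x ∈ ⋃₀ 𝒬
            · exact absurd ⟨hxQ, e⟩ hxU
            · rw [hgz x hxQ]; simp; linarith
          · rw [e, Pi.single_eq_same]; linarith
          · have := neg_le_of_abs_le (e i); linarith
      · rw [indicator_of_notMem hxV, indicator_of_notMem fun hc => hxV (hUV hc),
          hgz x fun hc => hxV (hQV hc)]
        simp
    rw [hinteg, integral_sub hi1 hi2, integral_indicator_const _ hUm,
      integral_indicator_const _ hV.isOpen.measurableSet] at hle
    simp only [smul_eq_mul, Measure.real] at hle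
    nlinarith

end

theorem lmap_vecMulVec [Fintype ι] (a : κ → ℝ) (g : (ι → ℝ) × ℝ) (x : ι → ℝ) :
    lmap (Matrix.vecMulVec a g.1) (g.2 • a) x = fun k => a k * affEval g x := by
  funext k
  simp only [lmap, Matrix.vecMulVec_apply, affEval, mul_add, Finset.mul_sum, Pi.smul_apply,
    smul_eq_mul, mul_assoc]
  ring

section

variable [Fintype ι] [DecidableEq ι] [Fintype κ]

/-- `B` lies on a rank-one segment in direction `a ⊗ eᵢ` with one end point in `𝓑'` and the other
one either in `𝓑'` or in `K'`; in the second case the end point in `𝓑'` has weight less than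
`q`. All entries involved are bounded by `r`. -/
def Splits (B : Matrix κ ι ℝ) (K' 𝓑' : Set (Matrix κ ι ℝ)) (q r : ℝ) : Prop :=
  ∃ (a : κ → ℝ) (i : ι) (l₁ l₂ : ℝ), 0 < l₁ ∧ 0 < l₂ ∧
    B + Matrix.vecMulVec a (Pi.single i l₁) ∈ 𝓑' ∧
    ((B + Matrix.vecMulVec a (Pi.single i (-l₂)) ∈ 𝓑' ∧ 1 ≤ q) ∨
      (B + Matrix.vecMulVec a (Pi.single i (-l₂)) ∈ K' ∧ l₂ / (l₁ + l₂) < q)) ∧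
    (∀ k l, |B k l| ≤ r) ∧
    (∀ k l, |(B + Matrix.vecMulVec a (Pi.single i l₁)) k l| ≤ r) ∧
    ∀ k l, |(B + Matrix.vecMulVec a (Pi.single i (-l₂))) k l| ≤ r

/-- A small perturbation of an affine map with gradient `B` on `V`, whose gradient lies in `𝓑'`
on the pieces `𝒩` and, up to a small set, in `K'` on the pieces `𝒟`. -/
structure IsSplitting (V : Set (ι → ℝ)) (B : Matrix κ ι ℝ) (K' 𝓑' : Set (Matrix κ ι ℝ))
    (q r θ α : ℝ) (w : (ι → ℝ) → κ → ℝ) (H : (ι → ℝ) → Matrix κ ι ℝ)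
    (𝒩 𝒟 : Set (Set (ι → ℝ))) : Prop where
  countable_new : 𝒩.Countable
  countable_done : 𝒟.Countable
  piece_new : ∀ W ∈ 𝒩, IsPolytope W ∧ W ⊆ V ∧
    ∃ C c, B + C ∈ 𝓑' ∧ ∀ x ∈ W, w x = lmap C c x ∧ H x = C
  piece_done : ∀ W ∈ 𝒟, IsPolytope W ∧ W ⊆ V ∧ ∃ C c, ∀ x ∈ W, w x = lmap C c x
  disj_new : 𝒩.PairwiseDisjoint id
  disj_done : 𝒟.PairwiseDisjoint id
  disj : Disjoint (⋃₀ 𝒩) (⋃₀ 𝒟)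
  cover : volume (V \ (⋃₀ 𝒩 ∪ ⋃₀ 𝒟)) = 0
  zero : ∀ x ∉ V, w x = 0
  grad_zero : ∀ x ∉ V, H x = 0
  small : ∀ x, ‖w x‖ ≤ θ
  holder : ∀ x y, dist (w x) (w y) ≤ θ * dist x y ^ α
  weak : ∀ k, IsWeakGrad (fun x => w x k) (fun x => H x k)
  bound : ∀ x k l, |(B + H x) k l| ≤ r + 1
  base_bound : ∀ k l, |B k l| ≤ r
  vol_new : volume (⋃₀ 𝒩) ≤ ENNReal.ofReal q * volume V
  err : volume {x ∈ ⋃₀ 𝒟 | B + H x ∉ K'} ≤ ENNReal.ofReal θ * volume V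

theorem IsWeakGrad.const_mul {f : (ι → ℝ) → ℝ} {h : (ι → ℝ) → ι → ℝ} (hw : IsWeakGrad f h)
    (c : ℝ) : IsWeakGrad (fun x => c * f x) (fun x l => c * h x l) := by
  refine ⟨hw.integrable.const_mul c, fun l => (hw.integrable_grad l).const_mul c,
    fun φ hφ hφc l => ?_⟩
  simp only [mul_assoc, integral_const_mul, hw.parts φ hφ hφc l, mul_neg]

theorem Splits.exists_isSplitting {B : Matrix κ ι ℝ} {K' 𝓑' : Set (Matrix κ ι ℝ)} {q r : ℝ}
    (hB : Splits B K' 𝓑' q r) {V : Set (ι → ℝ)} (hV : IsPolytope V) {θ α : ℝ} (hθ : 0 < θ)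
    (hα : α ∈ Ioo (0 : ℝ) 1) :
    ∃ w H 𝒩 𝒟, IsSplitting V B K' 𝓑' q r θ α w H 𝒩 𝒟 := by
  classical
  obtain ⟨a, i, l₁, l₂, hl₁, hl₂, hX₁, hX₂, hBr, hX₁r, hX₂r⟩ := hB
  obtain ⟨η, hη, hηq⟩ : ∃ η > 0, l₂ / (l₁ + l₂) < q → (l₂ + η) ≤ q * (l₁ + l₂) := by
    by_cases hq : l₂ / (l₁ + l₂) < q
    · rw [div_lt_iff₀ (by positivity)] at hq
      exact ⟨q * (l₁ + l₂) - l₂, by linarith, fun _ => by linarith⟩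
    · exact ⟨1, one_pos, fun h => absurd h hq⟩
  set t : ℝ := min (min θ 1) η / (1 + ‖a‖) with ht
  have hm : 0 < min (min θ 1) η := by positivity
  have ha0 : 0 ≤ ‖a‖ := norm_nonneg a
  have ht0 : 0 < t := by positivity
  have hat : t * (1 + ‖a‖) = min (min θ 1) η := by rw [ht]; field_simp
  have hta : 0 ≤ t * ‖a‖ := by positivity
  have hmθ : min (min θ 1) η ≤ θ := (min_le_left _ _).trans (min_le_left _ _)
  have hm1 : min (min θ 1) η ≤ 1 := (min_le_left _ _).trans (min_le_right _ _)
  have hmη : min (min θ 1) η ≤ η := min_le_right _ _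
  have htθ : t ≤ θ := by linarith
  have haθ : ∀ k, |a k| * t ≤ θ := fun k => by
    have h1 := mul_le_mul_of_nonneg_right (norm_le_pi_norm a k) ht0.le
    rw [Real.norm_eq_abs] at h1
    linarith
  have ha1 : ∀ k, |a k| * t ≤ 1 := fun k => by
    have h1 := mul_le_mul_of_nonneg_right (norm_le_pi_norm a k) ht0.le
    rw [Real.norm_eq_abs] at h1
    linarith
  obtain ⟨f, h, 𝒬, hs⟩ := exists_isSawtooth hV i hl₁ hl₂ ht0 hα
  have hQV : ⋃₀ 𝒬 ⊆ V := sUnion_subset fun W hW => (hs.piece W hW).2.1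
  -- everything except the choice of the new pieces
  have main : ∀ P : (ι → ℝ) → Prop,
      (∀ ξ, P ξ → B + Matrix.vecMulVec a ξ ∈ 𝓑') →
      volume {x ∈ ⋃₀ 𝒬 | P (h x)} ≤ ENNReal.ofReal q * volume V →
      (∀ ξ, ¬ P ξ → B + Matrix.vecMulVec a ξ ∉ K' →
        ξ ≠ Pi.single i l₁ ∧ ξ ≠ Pi.single i (-l₂)) →
      ∃ w H 𝒩 𝒟, IsSplitting V B K' 𝓑' q r θ α w H 𝒩 𝒟 := by
    intro P hP hvol herr
    have hconst : ∀ W ∈ 𝒬, ∀ x ∈ W, ∀ y ∈ W, h x = h y := by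
      intro W hW x hx y hy
      obtain ⟨g, hg⟩ := (hs.piece W hW).2.2
      rw [(hg x hx).2, (hg y hy).2]
    refine ⟨fun x k => a k * f x, fun x => Matrix.vecMulVec a (h x),
      {W ∈ 𝒬 | ∃ x ∈ W, P (h x)}, {W ∈ 𝒬 | ¬ ∃ x ∈ W, P (h x)}, ?_⟩
    have hun : ⋃₀ {W ∈ 𝒬 | ∃ x ∈ W, P (h x)} = {x ∈ ⋃₀ 𝒬 | P (h x)} := by
      ext x
      constructor
      · rintro ⟨W, ⟨hW, y, hy, hPy⟩, hx⟩
        exact ⟨⟨W, hW, hx⟩, by rwa [hconst W hW x hx y hy]⟩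
      · rintro ⟨⟨W, hW, hx⟩, hPx⟩
        exact ⟨W, ⟨hW, x, hx, hPx⟩, hx⟩
    have hud : ⋃₀ {W ∈ 𝒬 | ¬ ∃ x ∈ W, P (h x)} = {x ∈ ⋃₀ 𝒬 | ¬ P (h x)} := by
      ext x
      constructor
      · rintro ⟨W, ⟨hW, hn⟩, hx⟩
        exact ⟨⟨W, hW, hx⟩, fun hPx => hn ⟨x, hx, hPx⟩⟩
      · rintro ⟨⟨W, hW, hx⟩, hPx⟩
        exact ⟨W, ⟨hW, fun ⟨y, hy, hPy⟩ => hPx (by rwa [hconst W hW x hx y hy])⟩, hx⟩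
    refine
      { countable_new := hs.countable.mono fun W hW => hW.1
        countable_done := hs.countable.mono fun W hW => hW.1
        piece_new := ?_
        piece_done := ?_
        disj_new := hs.disj.subset fun W hW => hW.1
        disj_done := hs.disj.subset fun W hW => hW.1
        disj := ?_
        cover := ?_
        zero := fun x hx => by funext k; simp [hs.zero x hx]
        grad_zero := fun x hx => by
          rw [hs.grad_zero x fun hc => hx (hQV hc)]; ext; simp [Matrix.vecMulVec_apply]
        small := fun x => ?_
        holder := fun x y => ?_
        weak := fun k => ?_
        bound := fun x k l => ?_
        base_bound := hBr
        vol_new := by rw [hun]; exact hvol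
        err := ?_ }
    · rintro W ⟨hW, x, hx, hPx⟩
      obtain ⟨h1, h2, g, hg⟩ := hs.piece W hW
      refine ⟨h1, h2, Matrix.vecMulVec a g.1, g.2 • a, ?_, fun y hy => ⟨?_, ?_⟩⟩
      · rw [← (hg x hx).2]; exact hP _ hPx
      · rw [lmap_vecMulVec, (hg y hy).1]
      · rw [(hg y hy).2]
    · rintro W ⟨hW, -⟩
      obtain ⟨h1, h2, g, hg⟩ := hs.piece W hW
      refine ⟨h1, h2, Matrix.vecMulVec a g.1, g.2 • a, fun y hy => ?_⟩
      rw [lmap_vecMulVec, (hg y hy).1]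
    · rw [hun, hud, Set.disjoint_left]
      exact fun x hx hx' => hx'.2 hx.2
    · rw [hun, hud]
      refine measure_mono_null (t := V \ ⋃₀ 𝒬) ?_ hs.cover
      rintro x ⟨hxV, hx⟩
      refine ⟨hxV, fun hxQ => hx ?_⟩
      by_cases hPx : P (h x)
      · exact Or.inl ⟨hxQ, hPx⟩
      · exact Or.inr ⟨hxQ, hPx⟩
    · refine (pi_norm_le_iff_of_nonneg hθ.le).2 fun k => ?_
      rw [Real.norm_eq_abs, abs_mul]
      exact (mul_le_mul_of_nonneg_left (hs.small x) (abs_nonneg _)).trans (haθ k)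
    · refine (dist_pi_le_iff (by positivity)).2 fun k => ?_
      rw [Real.dist_eq, ← mul_sub, abs_mul]
      refine (mul_le_mul_of_nonneg_left (hs.holder x y) (abs_nonneg _)).trans ?_
      rw [← mul_assoc]
      exact mul_le_mul_of_nonneg_right (haθ k) (by positivity)
    · exact hs.weak.const_mul (a k)
    · rcases hs.vals x with e | e | e
      · rw [e]; exact (hX₁r k l).trans (by linarith)
      · rw [e]; exact (hX₂r k l).trans (by linarith)
      · rw [Matrix.add_apply, Matrix.vecMulVec_apply]
        refine (abs_add_le _ _).trans (add_le_add (hBr k l) ?_)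
        rw [abs_mul]
        exact (mul_le_mul_of_nonneg_left (e l) (abs_nonneg _)).trans (ha1 k)
    · rw [hud]
      refine (measure_mono ?_).trans (hs.err.trans ?_)
      · rintro x ⟨⟨hxQ, hPx⟩, hxK⟩
        exact ⟨hxQ, herr _ hPx hxK⟩
      · gcongr
  rcases hX₂ with ⟨hX₂, hq⟩ | ⟨hX₂, hq⟩
  · refine main (fun ξ => ξ = Pi.single i l₁ ∨ ξ = Pi.single i (-l₂)) ?_ ?_ ?_
    · rintro _ (rfl | rfl)
      exacts [hX₁, hX₂]
    · calc volume {x ∈ ⋃₀ 𝒬 | h x = Pi.single i l₁ ∨ h x = Pi.single i (-l₂)} ≤ volume V :=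
            measure_mono fun x hx => hQV hx.1
        _ = 1 * volume V := (one_mul _).symm
        _ ≤ ENNReal.ofReal q * volume V := by gcongr; simpa using hq
    · exact fun ξ hξ _ => not_or.1 hξ
  · refine main (fun ξ => ξ = Pi.single i l₁) ?_ ?_ ?_
    · rintro _ rfl
      exact hX₁
    · have hup := hs.up
      have hl : 0 < l₁ + l₂ := by positivity
      have hV0 : 0 ≤ (volume V).toReal := ENNReal.toReal_nonneg
      have hq0 : 0 ≤ q := le_trans (by positivity) hq.le
      have htη : t ≤ η := by linarith
      have h2 : (volume {x ∈ ⋃₀ 𝒬 | h x = Pi.single i l₁}).toReal ≤ q * (volume V).toReal := by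
        have h3 : (l₂ + t) * (volume V).toReal ≤ q * (l₁ + l₂) * (volume V).toReal :=
          mul_le_mul_of_nonneg_right (by linarith [hηq hq]) hV0
        by_contra! hc
        have := mul_lt_mul_of_pos_left hc hl
        linarith
      have hfin : volume {x ∈ ⋃₀ 𝒬 | h x = Pi.single i l₁} ≠ ⊤ :=
        ((measure_mono fun x hx => hQV hx.1).trans_lt hV.volume_lt_top).ne
      rw [← ENNReal.ofReal_toReal hfin, ← ENNReal.ofReal_toReal hV.volume_lt_top.ne,
        ← ENNReal.ofReal_mul hq0]
      exact ENNReal.ofReal_le_ofReal h2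
    · intro ξ hξ hK
      refine ⟨hξ, ?_⟩
      rintro rfl
      exact hK hX₂

end

/-- A uniformly bounded function glued from integrable functions living on disjoint sets of finite
total measure is integrable. -/
theorem integrable_of_glue {X I : Type*} [MeasurableSpace X] {μ : Measure X} [Countable I]
    {S : I → Set X} (hS : ∀ i, MeasurableSet (S i)) (hfin : μ (⋃ i, S i) ≠ ⊤) {F : X → ℝ}
    {f : I → X → ℝ} (hF : ∀ i, ∀ x ∈ S i, F x = f i x) (hF0 : ∀ x, (∀ i, x ∉ S i) → F x = 0)
    (hf : ∀ i, Integrable (f i) μ) {C : ℝ} (hC : ∀ i x, |f i x| ≤ C) : Integrable F μ := by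
  have hm : AEStronglyMeasurable F (μ.restrict (⋃ i, S i)) := by
    rw [aestronglyMeasurable_iUnion_iff]
    intro i
    refine (hf i).1.restrict.congr ?_
    filter_upwards [ae_restrict_mem (hS i)] with x hx using (hF i x hx).symm
  have hind : (⋃ i, S i).indicator F = F := by
    rw [indicator_eq_self]
    intro x hx
    by_contra hc
    exact hx (hF0 x fun i hi => hc (mem_iUnion.2 ⟨i, hi⟩))
  have hm' : AEStronglyMeasurable F μ := by
    rw [← hind]
    exact (aestronglyMeasurable_indicator_iff (MeasurableSet.iUnion hS)).2 hm
  rw [← hind, integrable_indicator_iff (MeasurableSet.iUnion hS)]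
  refine Measure.integrableOn_of_bounded hfin hm' (M := C) ?_
  filter_upwards [ae_restrict_mem (MeasurableSet.iUnion hS)] with x hx
  obtain ⟨i, hi⟩ := mem_iUnion.1 hx
  rw [hF i x hi]
  exact hC i x

theorem integral_glue {X I : Type*} [MeasurableSpace X] {μ : Measure X} [Countable I]
    {S : I → Set X} (hS : ∀ i, MeasurableSet (S i)) (hd : Pairwise (Function.onFun Disjoint S))
    {F : X → ℝ} {f : I → X → ℝ} (hF : ∀ i, ∀ x ∈ S i, F x = f i x)
    (hF0 : ∀ x, (∀ i, x ∉ S i) → F x = 0) (hf0 : ∀ i, ∀ x ∉ S i, f i x = 0)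
    (hinteg : Integrable F μ) : ∫ x, F x ∂μ = ∑' i, ∫ x, f i x ∂μ := by
  rw [← setIntegral_eq_integral_of_forall_compl_eq_zero (s := ⋃ i, S i) fun x hx =>
    hF0 x fun i hi => hx (mem_iUnion.2 ⟨i, hi⟩), integral_iUnion hS hd hinteg.integrableOn]
  congr 1
  funext i
  rw [← setIntegral_eq_integral_of_forall_compl_eq_zero (s := S i) (hf0 i)]
  exact setIntegral_congr_fun (hS i) (hF i)

section

variable [Fintype ι]

theorem continuous_fderiv_apply {φ : (ι → ℝ) → ℝ} (hφ : ∀ n : ℕ, ContDiff ℝ n φ) (v : ι → ℝ) :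
    Continuous fun x => fderiv ℝ φ x v :=
  ((hφ 1).continuous_fderiv (by simp)).clm_apply continuous_const

theorem exists_bound_fderiv {φ : (ι → ℝ) → ℝ} (hφ : ∀ n : ℕ, ContDiff ℝ n φ)
    (hφc : HasCompactSupport φ) (v : ι → ℝ) : ∃ C, ∀ x, ‖fderiv ℝ φ x v‖ ≤ C :=
  (continuous_fderiv_apply hφ v).bounded_above_of_compact_support (hφc.fderiv_apply (𝕜 := ℝ) v)

theorem integrable_mul_fderiv {μ : Measure (ι → ℝ)} {f : (ι → ℝ) → ℝ} (hf : Integrable f μ)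
    {φ : (ι → ℝ) → ℝ} (hφ : ∀ n : ℕ, ContDiff ℝ n φ) (hφc : HasCompactSupport φ) (v : ι → ℝ) :
    Integrable (fun x => f x * fderiv ℝ φ x v) μ := by
  obtain ⟨C, hC⟩ := exists_bound_fderiv hφ hφc v
  exact hf.mul_bdd (continuous_fderiv_apply hφ v).aestronglyMeasurable (Eventually.of_forall hC)

theorem integrable_mul_test {μ : Measure (ι → ℝ)} {f : (ι → ℝ) → ℝ} (hf : Integrable f μ)
    {φ : (ι → ℝ) → ℝ} (hφ : ∀ n : ℕ, ContDiff ℝ n φ) (hφc : HasCompactSupport φ) :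
    Integrable (fun x => f x * φ x) μ := by
  obtain ⟨C, hC⟩ := (hφ 0).continuous.bounded_above_of_compact_support hφc
  exact hf.mul_bdd (hφ 0).continuous.aestronglyMeasurable (Eventually.of_forall hC)

variable [DecidableEq ι]

theorem isWeakGrad_of_glue {I : Type*} [Countable I] {S : I → Set (ι → ℝ)}
    (hS : ∀ i, MeasurableSet (S i)) (hd : Pairwise (Function.onFun Disjoint S))
    (hfin : volume (⋃ i, S i) ≠ ⊤) {F : (ι → ℝ) → ℝ} {h : (ι → ℝ) → ι → ℝ}
    {f : I → (ι → ℝ) → ℝ} {g : I → (ι → ℝ) → ι → ℝ} (hF : ∀ i, ∀ x ∈ S i, F x = f i x)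
    (hF0 : ∀ x, (∀ i, x ∉ S i) → F x = 0) (hf0 : ∀ i, ∀ x ∉ S i, f i x = 0)
    (hh : ∀ i, ∀ x ∈ S i, h x = g i x) (hh0 : ∀ x, (∀ i, x ∉ S i) → h x = 0)
    (hg0 : ∀ i, ∀ x ∉ S i, g i x = 0) {C : ℝ} (hfC : ∀ i x, |f i x| ≤ C)
    (hgC : ∀ i x l, |g i x l| ≤ C) (hw : ∀ i, IsWeakGrad (f i) (g i)) : IsWeakGrad F h := by
  have hFi : Integrable F :=
    integrable_of_glue hS hfin hF hF0 (fun i => (hw i).integrable) hfC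
  have hhi : ∀ l, Integrable fun x => h x l := fun l =>
    integrable_of_glue hS hfin (f := fun i x => g i x l) (fun i x hx => by rw [hh i x hx])
      (fun x hx => by rw [hh0 x hx]; rfl) (fun i => (hw i).integrable_grad l)
      fun i x => hgC i x l
  refine ⟨hFi, hhi, fun φ hφ hφc l => ?_⟩
  rw [integral_glue hS hd (f := fun i x => f i x * fderiv ℝ φ x (Pi.single l 1))
      (fun i x hx => by rw [hF i x hx]) (fun x hx => by rw [hF0 x hx, zero_mul])
      (fun i x hx => by rw [hf0 i x hx, zero_mul]) (integrable_mul_fderiv hFi hφ hφc _),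
    integral_glue hS hd (f := fun i x => g i x l * φ x)
      (fun i x hx => by rw [hh i x hx]) (fun x hx => by rw [hh0 x hx]; simp)
      (fun i x hx => by rw [hg0 i x hx]; simp) (integrable_mul_test (hhi l) hφ hφc), ← tsum_neg]
  congr 1
  funext i
  exact (hw i).parts φ hφ hφc l

theorem HasWeakGradientOn.add_isWeakGrad [Fintype κ] {U w : (ι → ℝ) → κ → ℝ}
    {G H : (ι → ℝ) → Matrix κ ι ℝ} {Ω : Set (ι → ℝ)}
    (hU : HasWeakGradientOn U G Ω) (hw : ∀ k, IsWeakGrad (fun x => w x k) fun x => H x k)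
    (hw0 : ∀ x ∉ Ω, w x = 0) (hH0 : ∀ x ∉ Ω, H x = 0) :
    HasWeakGradientOn (fun x => U x + w x) (fun x => G x + H x) Ω := by
  have hwi : Integrable w := Integrable.of_eval fun k => (hw k).integrable
  refine ⟨hU.integrable.add hwi.integrableOn, fun k i => ?_, fun φ hφ hφc hφs k i => ?_⟩
  · exact (hU.integrable_grad k i).add ((hw k).integrable_grad i).integrableOn
  · have hUk : IntegrableOn (fun x => U x k) Ω := hU.integrable.eval k
    have e1 := hU.parts φ hφ hφc hφs k i
    have e2 : ∫ x in Ω, w x k * fderiv ℝ φ x (Pi.single i 1) = - ∫ x in Ω, H x k i * φ x := by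
      rw [setIntegral_eq_integral_of_forall_compl_eq_zero fun x hx => by rw [hw0 x hx]; simp,
        setIntegral_eq_integral_of_forall_compl_eq_zero fun x hx => by rw [hH0 x hx]; simp]
      exact (hw k).parts φ hφ hφc i
    have a1 := integral_add (integrable_mul_fderiv hUk hφ hφc (Pi.single i 1))
      (integrable_mul_fderiv ((hw k).integrable.integrableOn (s := Ω)) hφ hφc (Pi.single i 1))
    have a2 := integral_add (integrable_mul_test (hU.integrable_grad k i) hφ hφc)
      (integrable_mul_test (((hw k).integrable_grad i).integrableOn (s := Ω)) hφ hφc)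
    simp only [Pi.add_apply, Matrix.add_apply, add_mul]
    rw [a1, e1, e2, ← neg_add, ← a2]

end

theorem lmap_add [Fintype ι] (B C : Matrix κ ι ℝ) (c d : κ → ℝ) (x : ι → ℝ) :
    lmap B c x + lmap C d x = lmap (B + C) (c + d) x := by
  funext k
  simp only [lmap, Pi.add_apply, Matrix.add_apply, add_mul, Finset.sum_add_distrib]
  ring

section

variable [Fintype ι] [DecidableEq ι] [Fintype κ]

/-- A map on `Ω` with affine boundary data which is still to be modified on the pieces `𝒮`, where
it is affine with gradient in `𝓑`. -/
structure IsStage (A : Matrix κ ι ℝ) (b : κ → ℝ) (Ω : Set (ι → ℝ)) (𝓑 : Set (Matrix κ ι ℝ))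
    (c : ℝ) (𝒮 : Set (Set (ι → ℝ))) (U : (ι → ℝ) → κ → ℝ) (G : (ι → ℝ) → Matrix κ ι ℝ) :
    Prop where
  countable : 𝒮.Countable
  disj : 𝒮.PairwiseDisjoint id
  piece : ∀ V ∈ 𝒮, IsPolytope V ∧ V ⊆ Ω ∧ ∃ B ∈ 𝓑, ∃ d, ∀ x ∈ V, U x = lmap B d x ∧ G x = B
  weak : HasWeakGradientOn U G Ω
  boundary : ∀ x ∉ Ω, U x = lmap A b x
  vol : volume (⋃₀ 𝒮) ≤ ENNReal.ofReal c * volume Ω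

/-- A modification of `U` on the pieces `𝒮`, leaving the pieces `𝒮'` for further modification and
having gradient in `K'` on most of the rest. -/
structure IsStep (Ω : Set (ι → ℝ)) (K' : Set (Matrix κ ι ℝ)) (r e δ α : ℝ)
    (𝒮 : Set (Set (ι → ℝ))) (U : (ι → ℝ) → κ → ℝ) (G : (ι → ℝ) → Matrix κ ι ℝ)
    (𝒮' : Set (Set (ι → ℝ))) (U' : (ι → ℝ) → κ → ℝ) (G' : (ι → ℝ) → Matrix κ ι ℝ) : Prop where
  subset : ⋃₀ 𝒮' ⊆ ⋃₀ 𝒮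
  eq_off : ∀ x ∉ ⋃₀ 𝒮, U' x = U x ∧ G' x = G x
  bound : ∀ x ∈ ⋃₀ 𝒮, ∀ k i, |G x k i| ≤ r + 1 ∧ |G' x k i| ≤ r + 1
  done : ∃ 𝒟 : Set (Set (ι → ℝ)), 𝒟.Countable ∧
    (∀ D ∈ 𝒟, IsPolytope D ∧ D ⊆ ⋃₀ 𝒮 ∧ IsAffineOn U' D) ∧ 𝒟.PairwiseDisjoint id ∧
    Disjoint (⋃₀ 𝒮') (⋃₀ 𝒟) ∧ volume (⋃₀ 𝒮 \ (⋃₀ 𝒮' ∪ ⋃₀ 𝒟)) = 0 ∧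
    volume {x ∈ ⋃₀ 𝒟 | G' x ∉ K'} ≤ ENNReal.ofReal e * volume Ω
  small : ∀ x, ‖U' x - U x‖ ≤ δ
  holder : ∀ x y, dist (U' x - U x) (U' y - U y) ≤ δ * dist x y ^ α

theorem sUnion_iUnion_pieces {X I : Type*} (𝒩 : I → Set (Set X)) (P : X → Prop) :
    {x ∈ ⋃₀ (⋃ i, 𝒩 i) | P x} = ⋃ i, {x ∈ ⋃₀ (𝒩 i) | P x} := by
  ext x
  simp only [mem_sUnion, mem_iUnion, mem_ofPred_eq]
  constructor
  · rintro ⟨⟨W, ⟨i, hi⟩, hx⟩, hP⟩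
    exact ⟨i, ⟨W, hi, hx⟩, hP⟩
  · rintro ⟨i, ⟨W, hi, hx⟩, hP⟩
    exact ⟨⟨W, ⟨i, hi⟩, hx⟩, hP⟩

theorem pairwiseDisjoint_iUnion_pieces {X I : Type*} {S : I → Set X}
    (hS : Pairwise (Function.onFun Disjoint S)) {𝒩 : I → Set (Set X)}
    (hsub : ∀ i, ∀ W ∈ 𝒩 i, W ⊆ S i) (hd : ∀ i, (𝒩 i).PairwiseDisjoint id) :
    (⋃ i, 𝒩 i).PairwiseDisjoint id := by
  intro W hW W' hW' hne
  obtain ⟨i, hi⟩ := mem_iUnion.1 hW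
  obtain ⟨j, hj⟩ := mem_iUnion.1 hW'
  by_cases hij : i = j
  · subst hij
    exact hd i hi hj hne
  · exact (hS hij).mono (hsub i W hi) (hsub j W' hj)

theorem IsStage.exists_step {A : Matrix κ ι ℝ} {b : κ → ℝ} {Ω : Set (ι → ℝ)}
    (hΩ : volume Ω ≠ ⊤) {𝓑 𝓑' K' : Set (Matrix κ ι ℝ)} {c q r : ℝ} {𝒮 : Set (Set (ι → ℝ))}
    {U : (ι → ℝ) → κ → ℝ} {G : (ι → ℝ) → Matrix κ ι ℝ} (hs : IsStage A b Ω 𝓑 c 𝒮 U G)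
    (h𝓑 : ∀ B ∈ 𝓑, Splits B K' 𝓑' q r) (hq : 0 ≤ q) {e δ α : ℝ} (he : 0 < e) (hδ : 0 < δ)
    (hα : α ∈ Ioo (0 : ℝ) 1) :
    ∃ 𝒮' U' G', IsStage A b Ω 𝓑' (q * c) 𝒮' U' G' ∧
      IsStep Ω K' r e δ α 𝒮 U G 𝒮' U' G' := by
  set θ : ℝ := min (δ / 2) e with hθd
  have hθ : 0 < θ := by positivity
  have hθδ : θ ≤ δ / 2 := min_le_left _ _
  have hθe : θ ≤ e := min_le_right _ _
  have : Countable 𝒮 := hs.countable.to_subtype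
  choose hpoly hVΩ B hB𝓑 d hUG using fun V : 𝒮 => hs.piece V V.2
  choose w H 𝒩 𝒟 hsp using fun V : 𝒮 =>
    (h𝓑 (B V) (hB𝓑 V)).exists_isSplitting (hpoly V) hθ hα
  have hdis : Pairwise (Function.onFun Disjoint fun V : 𝒮 => (V : Set (ι → ℝ))) :=
    fun V V' hne => hs.disj V.2 V'.2 fun h => hne (Subtype.ext h)
  have huniq : ∀ (V V' : 𝒮) (x : ι → ℝ), x ∈ (V : Set (ι → ℝ)) → x ∈ (V' : Set (ι → ℝ)) →
      V = V' := fun V V' x hx hx' => by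
    by_contra hne
    exact Set.disjoint_left.1 (hdis hne) hx hx'
  have hmeas : ∀ V : 𝒮, MeasurableSet (V : Set (ι → ℝ)) := fun V =>
    (hpoly V).isOpen.measurableSet
  have hSU : ⋃₀ 𝒮 = ⋃ V : 𝒮, (V : Set (ι → ℝ)) := sUnion_eq_iUnion
  have hSΩ : ⋃₀ 𝒮 ⊆ Ω := sUnion_subset fun V hV => hVΩ ⟨V, hV⟩
  have hvolS : ∑' V : 𝒮, volume (V : Set (ι → ℝ)) = volume (⋃₀ 𝒮) := by
    rw [hSU, measure_iUnion hdis hmeas]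
  obtain ⟨w', hw', hw0⟩ := exists_glue (fun V : 𝒮 => (V : Set (ι → ℝ))) huniq w
  obtain ⟨H', hH', hH0⟩ := exists_glue (fun V : 𝒮 => (V : Set (ι → ℝ))) huniq H
  have hnot : ∀ x ∉ ⋃₀ 𝒮, ∀ V : 𝒮, x ∉ (V : Set (ι → ℝ)) := fun x hx V hxV =>
    hx ⟨V, V.2, hxV⟩
  have hsubN : ∀ V : 𝒮, ∀ W ∈ 𝒩 V, W ⊆ V := fun V W hW => ((hsp V).piece_new W hW).2.1
  have hsubD : ∀ V : 𝒮, ∀ W ∈ 𝒟 V, W ⊆ V := fun V W hW => ((hsp V).piece_done W hW).2.1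
  have hVS : ∀ V : 𝒮, (V : Set (ι → ℝ)) ⊆ ⋃₀ 𝒮 := fun V => subset_sUnion_of_mem V.2
  have hHb : ∀ (V : 𝒮) x k l, |H V x k l| ≤ 2 * r + 1 := fun V x k l => by
    have h1 := (hsp V).bound x k l
    have h2 := (hsp V).base_bound k l
    rw [Matrix.add_apply] at h1
    rw [abs_le] at h1 h2 ⊢
    constructor <;> linarith [h1.1, h1.2, h2.1, h2.2]
  have hweak : ∀ k, IsWeakGrad (fun x => w' x k) fun x => H' x k := fun k =>
    isWeakGrad_of_glue (C := max θ (2 * r + 1)) hmeas hdis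
      (by rw [← hSU]; exact ((measure_mono hSΩ).trans_lt hΩ.lt_top).ne)
      (f := fun V x => w V x k) (g := fun V x => H V x k)
      (fun V x hx => by rw [hw' V x hx]) (fun x hx => by rw [hw0 x hx]; rfl)
      (fun V x hx => by rw [(hsp V).zero x hx]; rfl)
      (fun V x hx => by rw [hH' V x hx]) (fun x hx => by rw [hH0 x hx]; rfl)
      (fun V x hx => by rw [(hsp V).grad_zero x hx]; rfl)
      (fun V x => ((norm_le_pi_norm (w V x) k).trans ((hsp V).small x)).trans (le_max_left _ _))
      (fun V x l => (hHb V x k l).trans (le_max_right _ _)) fun V => (hsp V).weak k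
  refine ⟨⋃ V, 𝒩 V, fun x => U x + w' x, fun x => G x + H' x, ?_, ?_⟩
  · refine ⟨countable_iUnion fun V => (hsp V).countable_new,
      pairwiseDisjoint_iUnion_pieces hdis hsubN fun V => (hsp V).disj_new, ?_, ?_, ?_, ?_⟩
    · intro W hW
      obtain ⟨V, hV⟩ := mem_iUnion.1 hW
      obtain ⟨h1, h2, C, c', h3, h4⟩ := (hsp V).piece_new W hV
      refine ⟨h1, h2.trans (hVΩ V), B V + C, h3, d V + c', fun x hx => ⟨?_, ?_⟩⟩
      · rw [(hUG V x (h2 hx)).1, hw' V x (h2 hx), (h4 x hx).1, lmap_add]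
      · rw [(hUG V x (h2 hx)).2, hH' V x (h2 hx), (h4 x hx).2]
    · refine hs.weak.add_isWeakGrad hweak (fun x hx => ?_) fun x hx => ?_
      · exact hw0 x (hnot x fun h => hx (hSΩ h))
      · exact hH0 x (hnot x fun h => hx (hSΩ h))
    · intro x hx
      simp only [hw0 x (hnot x fun h => hx (hSΩ h)), add_zero]
      exact hs.boundary x hx
    · have e1 : ⋃₀ (⋃ V, 𝒩 V) = ⋃ V, ⋃₀ (𝒩 V) := sUnion_iUnion 𝒩
      calc volume (⋃₀ (⋃ V, 𝒩 V)) ≤ ∑' V, volume (⋃₀ (𝒩 V)) := by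
            rw [e1]; exact measure_iUnion_le _
        _ ≤ ∑' V : 𝒮, ENNReal.ofReal q * volume (V : Set (ι → ℝ)) :=
            ENNReal.tsum_le_tsum fun V => (hsp V).vol_new
        _ = ENNReal.ofReal q * volume (⋃₀ 𝒮) := by rw [ENNReal.tsum_mul_left, hvolS]
        _ ≤ ENNReal.ofReal q * (ENNReal.ofReal c * volume Ω) := by gcongr; exact hs.vol
        _ = ENNReal.ofReal (q * c) * volume Ω := by rw [ENNReal.ofReal_mul hq, mul_assoc]
  · have hsm : ∀ x, ‖w' x‖ ≤ θ := fun x => by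
      by_cases hx : x ∈ ⋃₀ 𝒮
      · obtain ⟨V, hV, hxV⟩ := hx
        rw [hw' ⟨V, hV⟩ x hxV]
        exact (hsp _).small x
      · rw [hw0 x (hnot x hx), norm_zero]; exact hθ.le
    -- `w'` agrees at any two points with the sum of at most two of the `w V`
    have hho : ∀ x y, dist (w' x) (w' y) ≤ 2 * θ * dist x y ^ α := by
      intro x y
      have hone : ∀ x y, ∀ V : 𝒮, x ∈ (V : Set (ι → ℝ)) → y ∉ (V : Set (ι → ℝ)) →
          ‖w' x‖ ≤ θ * dist x y ^ α := fun x y V hx hy => by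
        have := (hsp V).holder x y
        rwa [(hsp V).zero y hy, dist_zero_right, ← hw' V x hx] at this
      have h0 : 0 ≤ θ * dist x y ^ α := by positivity
      by_cases hx : ∃ V : 𝒮, x ∈ (V : Set (ι → ℝ))
      · obtain ⟨V, hxV⟩ := hx
        by_cases hyV : y ∈ (V : Set (ι → ℝ))
        · rw [hw' V x hxV, hw' V y hyV]
          linarith [(hsp V).holder x y]
        · have h1 := hone x y V hxV hyV
          by_cases hy : ∃ V : 𝒮, y ∈ (V : Set (ι → ℝ))
          · obtain ⟨V', hyV'⟩ := hy
            have hxV' : x ∉ (V' : Set (ι → ℝ)) := fun h => hyV (by rwa [huniq V V' x hxV h])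
            have h2 := hone y x V' hyV' hxV'
            rw [dist_comm y x] at h2
            rw [dist_eq_norm]
            linarith [norm_sub_le (w' x) (w' y)]
          · rw [hw0 y (not_exists.1 hy), dist_zero_right]
            linarith
      · rw [hw0 x (not_exists.1 hx), dist_zero_left]
        by_cases hy : ∃ V : 𝒮, y ∈ (V : Set (ι → ℝ))
        · obtain ⟨V', hyV'⟩ := hy
          have h2 := hone y x V' hyV' (not_exists.1 hx V')
          rw [dist_comm y x] at h2
          linarith
        · rw [hw0 y (not_exists.1 hy), norm_zero]
          linarith
    refine ⟨?_, ?_, ?_, ?_, fun x => ?_, fun x y => ?_⟩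
    · rintro x ⟨W, hW, hx⟩
      obtain ⟨V, hV⟩ := mem_iUnion.1 hW
      exact hVS V (hsubN V W hV hx)
    · intro x hx
      rw [hw0 x (hnot x hx), hH0 x (hnot x hx)]
      simp
    · rintro x ⟨V, hV, hx⟩ k i
      have e1 := (hUG ⟨V, hV⟩ x hx).2
      rw [hH' ⟨V, hV⟩ x hx, e1]
      exact ⟨((hsp ⟨V, hV⟩).base_bound k i).trans (by linarith), (hsp ⟨V, hV⟩).bound x k i⟩
    · have e1 : ⋃₀ (⋃ V, 𝒩 V) = ⋃ V, ⋃₀ (𝒩 V) := sUnion_iUnion 𝒩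
      have e2 : ⋃₀ (⋃ V, 𝒟 V) = ⋃ V, ⋃₀ (𝒟 V) := sUnion_iUnion 𝒟
      have hN : ∀ V : 𝒮, ⋃₀ (𝒩 V) ⊆ V := fun V => sUnion_subset (hsubN V)
      have hD : ∀ V : 𝒮, ⋃₀ (𝒟 V) ⊆ V := fun V => sUnion_subset (hsubD V)
      refine ⟨⋃ V, 𝒟 V, countable_iUnion fun V => (hsp V).countable_done, ?_,
        pairwiseDisjoint_iUnion_pieces hdis hsubD fun V => (hsp V).disj_done, ?_, ?_, ?_⟩
      · intro W hW
        obtain ⟨V, hV⟩ := mem_iUnion.1 hW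
        obtain ⟨h1, h2, C, c', h4⟩ := (hsp V).piece_done W hV
        refine ⟨h1, h2.trans (hVS V), B V + C, d V + c', fun x hx => ?_⟩
        change U x + w' x = _
        rw [(hUG V x (h2 hx)).1, hw' V x (h2 hx), h4 x hx, lmap_add]
      · rw [e1, e2, disjoint_iUnion_left]
        refine fun V => disjoint_iUnion_right.2 fun V' => ?_
        by_cases hVV : V = V'
        · subst hVV; exact (hsp V).disj
        · exact (hdis hVV).mono (hN V) (hD V')
      · refine measure_mono_null (t := ⋃ V : 𝒮, ((V : Set (ι → ℝ)) \ (⋃₀ 𝒩 V ∪ ⋃₀ 𝒟 V))) ?_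
          (measure_iUnion_null fun V => (hsp V).cover)
        rintro x ⟨⟨V, hV, hx⟩, hn⟩
        refine mem_iUnion.2 ⟨⟨V, hV⟩, hx, fun h => hn ?_⟩
        rw [e1, e2]
        exact h.imp (fun h => mem_iUnion.2 ⟨_, h⟩) fun h => mem_iUnion.2 ⟨_, h⟩
      · rw [sUnion_iUnion_pieces]
        calc volume (⋃ V, {x ∈ ⋃₀ 𝒟 V | G x + H' x ∉ K'})
            ≤ ∑' V, volume {x ∈ ⋃₀ 𝒟 V | G x + H' x ∉ K'} := measure_iUnion_le _
          _ ≤ ∑' V : 𝒮, ENNReal.ofReal e * volume (V : Set (ι → ℝ)) := by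
              refine ENNReal.tsum_le_tsum fun V => ?_
              refine (measure_mono ?_).trans ((hsp V).err.trans ?_)
              · rintro x ⟨hx, hxK⟩
                refine ⟨hx, ?_⟩
                rwa [← hH' V x (hD V hx), ← (hUG V x (hD V hx)).2]
              · gcongr
          _ = ENNReal.ofReal e * volume (⋃₀ 𝒮) := by rw [ENNReal.tsum_mul_left, hvolS]
          _ ≤ ENNReal.ofReal e * volume Ω := by gcongr
    · rw [add_sub_cancel_left]
      linarith [hsm x]
    · rw [add_sub_cancel_left, add_sub_cancel_left]
      refine (hho x y).trans (mul_le_mul_of_nonneg_right (by linarith) (by positivity))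

end

section

variable [Fintype ι]

theorem lmap_apply (A : Matrix κ ι ℝ) (b : κ → ℝ) (x : ι → ℝ) (k : κ) :
    lmap A b x k = affEval (A k, b k) x := rfl

theorem continuous_lmap (A : Matrix κ ι ℝ) (b : κ → ℝ) : Continuous (lmap A b) :=
  continuous_pi fun k => continuous_affEval (A k, b k)

theorem hasWeakGradientOn_lmap [DecidableEq ι] [Fintype κ] (A : Matrix κ ι ℝ) (b : κ → ℝ)
    {Ω : Set (ι → ℝ)} (hΩ : Bornology.IsBounded Ω) :
    HasWeakGradientOn (lmap A b) (fun _ => A) Ω := by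
  have hcl : IsCompact (closure Ω) :=
    Metric.isCompact_of_isClosed_isBounded isClosed_closure hΩ.closure
  have hfin : volume Ω < ⊤ := hΩ.measure_lt_top
  refine ⟨((continuous_lmap A b).continuousOn.integrableOn_compact hcl).mono_set subset_closure,
    fun k i => integrableOn_const hfin.ne, fun φ hφ hφc hφs k i => ?_⟩
  have hφ0 : ∀ x ∉ Ω, φ x = 0 := fun x hx => image_eq_zero_of_notMem_tsupport fun h => hx (hφs h)
  have hφ0' : ∀ x ∉ Ω, fderiv ℝ φ x (Pi.single i 1) = 0 := fun x hx => by
    rw [image_eq_zero_of_notMem_tsupport (f := fderiv ℝ φ) fun h =>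
      hx (hφs (tsupport_fderiv_subset ℝ h))]
    rfl
  rw [setIntegral_eq_integral_of_forall_compl_eq_zero fun x hx => by rw [hφ0' x hx, mul_zero],
    setIntegral_eq_integral_of_forall_compl_eq_zero fun x hx => by rw [hφ0 x hx, mul_zero]]
  have hfd : ∀ x, fderiv ℝ (affEval (A k, b k)) x (Pi.single i 1) = A k i := fun x => by
    rw [(hasFDerivAt_affEval (A k, b k) x).fderiv]
    simp [Pi.single_apply]
  have hφcont := (hφ 0).continuous
  have hac := continuous_affEval (A k, b k)
  have key := integral_mul_fderiv_eq_neg_fderiv_mul_of_integrable (μ := volume)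
    (f := affEval (A k, b k)) (g := φ) (v := Pi.single i 1)
    (by
      simp only [hfd]
      exact (continuous_const.mul hφcont).integrable_of_hasCompactSupport hφc.mul_left)
    ((hac.mul (continuous_fderiv_apply hφ _)).integrable_of_hasCompactSupport
      (hφc.fderiv_apply (𝕜 := ℝ) _).mul_left)
    ((hac.mul hφcont).integrable_of_hasCompactSupport hφc.mul_left)
    (fun x _ => (hasFDerivAt_affEval (A k, b k) x).differentiableAt)
    fun x _ => (hφ 1).differentiable (by simp) x
  simp only [hfd] at key
  simpa only [lmap_apply] using key

/-- Almost all of an open set is a disjoint union of countably many cubes. -/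
theorem exists_polytope_covering {Ω : Set (ι → ℝ)} (hΩ : IsOpen Ω) :
    ∃ 𝒮 : Set (Set (ι → ℝ)), 𝒮.Countable ∧ 𝒮.PairwiseDisjoint id ∧
      (∀ V ∈ 𝒮, IsPolytope V ∧ V ⊆ Ω) ∧ volume (Ω \ ⋃₀ 𝒮) = 0 := by
  rcases isEmpty_or_nonempty ι with hι | hι
  · refine ⟨{Ω}, countable_singleton _, pairwiseDisjoint_singleton _ _, ?_, by simp⟩
    rintro V rfl
    refine ⟨?_, subset_rfl⟩
    rcases V.eq_empty_or_nonempty with h | h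
    · exact ⟨Set.subsingleton_of_subsingleton.finite.isBounded, {(0, -1)}, by
        rw [h]; ext x; simp [affEval]⟩
    · exact ⟨Set.subsingleton_of_subsingleton.finite.isBounded, ∅, by
        rw [Subsingleton.eq_univ_of_nonempty h]; simp⟩
  obtain ⟨t, ρ, htc, htΩ, hρ, hcov, hdisj⟩ := Besicovitch.exists_disjoint_closedBall_covering_ae
    (volume : Measure (ι → ℝ)) (fun x => {r | Metric.closedBall x r ⊆ Ω}) Ω
    (fun x hx δ hδ => by
      obtain ⟨r, hr, hrΩ⟩ := Metric.nhds_basis_closedBall.mem_iff.1 (hΩ.mem_nhds hx)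
      refine ⟨min r (δ / 2), (Metric.closedBall_subset_closedBall (min_le_left _ _)).trans hrΩ,
        by positivity, (min_le_right _ _).trans_lt (by linarith)⟩) (fun _ => 1) (by simp)
  refine ⟨(fun x => Metric.ball x (ρ x)) '' t, htc.image _, ?_, ?_, ?_⟩
  · rintro _ ⟨x, hx, rfl⟩ _ ⟨y, hy, rfl⟩ hne
    exact (hdisj hx hy fun h => hne (by rw [h])).mono Metric.ball_subset_closedBall
      Metric.ball_subset_closedBall
  · rintro _ ⟨x, hx, rfl⟩
    exact ⟨isPolytope_ball x _ (hρ x hx).2.1, Metric.ball_subset_closedBall.trans (hρ x hx).1⟩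
  · have := htc.to_subtype
    refine measure_mono_null (t := (Ω \ ⋃ x ∈ t, Metric.closedBall x (ρ x)) ∪
      ⋃ x : t, Metric.sphere (x : ι → ℝ) (ρ x)) ?_ (measure_union_null hcov
      (measure_iUnion_null fun x => Measure.addHaar_sphere_of_ne_zero _ _ (hρ x x.2).2.1.ne'))
    rintro y ⟨hyΩ, hy⟩
    by_cases hyc : y ∈ ⋃ x ∈ t, Metric.closedBall x (ρ x)
    · obtain ⟨x, hx, hyx⟩ := mem_iUnion₂.1 hyc
      refine Or.inr (mem_iUnion.2 ⟨⟨x, hx⟩, ?_⟩)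
      refine le_antisymm hyx (not_lt.1 fun h => hy ⟨_, ⟨x, hx, rfl⟩, h⟩)
    · exact Or.inl ⟨hyΩ, hyc⟩

end

theorem exists_seq_of_step {σ : Type*} {P : ℕ → σ → Prop} {Q : ℕ → σ → σ → Prop} {s₀ : σ}
    (h₀ : P 0 s₀) (hstep : ∀ n s, P n s → ∃ s', P (n + 1) s' ∧ Q n s s') :
    ∃ f : ℕ → σ, f 0 = s₀ ∧ ∀ n, P n (f n) ∧ Q n (f n) (f (n + 1)) := by
  choose next hP hQ using hstep
  let g : (n : ℕ) → {s // P n s} := fun n =>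
    Nat.rec ⟨s₀, h₀⟩ (fun n s => ⟨next n s s.2, hP n s s.2⟩) n
  exact ⟨fun n => (g n).1, rfl, fun n => ⟨(g n).2, hQ n (g n).1 (g n).2⟩⟩

section

variable [Fintype ι] [DecidableEq ι] [Fintype κ]

/-- A sequence of maps obtained by successive modifications on the decreasing sets `E j`. -/
structure IsScheme (A : Matrix κ ι ℝ) (b : κ → ℝ) (Ω : Set (ι → ℝ)) (K' : Set (Matrix κ ι ℝ))
    (c r e : ℕ → ℝ) (α : ℝ) (E : ℕ → Set (ι → ℝ)) (𝒟 : ℕ → Set (Set (ι → ℝ)))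
    (U : ℕ → (ι → ℝ) → κ → ℝ) (G : ℕ → (ι → ℝ) → Matrix κ ι ℝ) : Prop where
  start : U 0 = lmap A b
  measurableSet : ∀ j, MeasurableSet (E j)
  subset : ∀ j, E j ⊆ Ω
  anti : Antitone E
  full : volume (Ω \ E 0) = 0
  weak : ∀ j, HasWeakGradientOn (U j) (G j) Ω
  boundary : ∀ j, ∀ x ∉ Ω, U j x = lmap A b x
  vol : ∀ j, volume (E j) ≤ ENNReal.ofReal (c j) * volume Ω
  eq_off : ∀ j, ∀ x ∉ E j, U (j + 1) x = U j x ∧ G (j + 1) x = G j x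
  bound : ∀ j, ∀ x ∈ E j, ∀ k i, |G j x k i| ≤ r j + 1 ∧ |G (j + 1) x k i| ≤ r j + 1
  countable : ∀ j, (𝒟 j).Countable
  piece : ∀ j, ∀ D ∈ 𝒟 j, IsPolytope D ∧ D ⊆ E j ∧ IsAffineOn (U (j + 1)) D
  disj : ∀ j, (𝒟 j).PairwiseDisjoint id
  disj_next : ∀ j, Disjoint (E (j + 1)) (⋃₀ 𝒟 j)
  cover : ∀ j, volume (E j \ (E (j + 1) ∪ ⋃₀ 𝒟 j)) = 0
  err : ∀ j, volume {x ∈ ⋃₀ 𝒟 j | G (j + 1) x ∉ K'} ≤ ENNReal.ofReal (e j) * volume Ω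
  small : ∀ j x, ‖U (j + 1) x - U j x‖ ≤ (1 / 2) ^ j
  holder : ∀ j x y,
    dist (U (j + 1) x - U j x) (U (j + 1) y - U j y) ≤ (1 / 2) ^ j * dist x y ^ α

theorem exists_isScheme {A : Matrix κ ι ℝ} (b : κ → ℝ) {Ω : Set (ι → ℝ)} (hΩ : IsOpen Ω)
    (hΩb : Bornology.IsBounded Ω) {K' : Set (Matrix κ ι ℝ)} {𝓑 : ℕ → Set (Matrix κ ι ℝ)}
    {c q r e : ℕ → ℝ} {α : ℝ} (hα : α ∈ Ioo (0 : ℝ) 1) (hA : A ∈ 𝓑 0) (hc0 : c 0 = 1)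
    (hc : ∀ j, c (j + 1) = q j * c j) (hq : ∀ j, 0 ≤ q j) (he : ∀ j, 0 < e j)
    (h𝓑 : ∀ j, ∀ B ∈ 𝓑 j, Splits B K' (𝓑 (j + 1)) (q j) (r j)) :
    ∃ E 𝒟 U G, IsScheme A b Ω K' c r e α E 𝒟 U G := by
  obtain ⟨𝒮₀, hS₀c, hS₀d, hS₀, hS₀v⟩ := exists_polytope_covering hΩ
  have hΩfin : volume Ω ≠ ⊤ := hΩb.measure_lt_top.ne
  have h0 : IsStage A b Ω (𝓑 0) (c 0) 𝒮₀ (lmap A b) fun _ => A :=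
    { countable := hS₀c
      disj := hS₀d
      piece := fun V hV => ⟨(hS₀ V hV).1, (hS₀ V hV).2, A, hA, b, fun x _ => ⟨rfl, rfl⟩⟩
      weak := hasWeakGradientOn_lmap A b hΩb
      boundary := fun x _ => rfl
      vol := by
        rw [hc0, ENNReal.ofReal_one, one_mul]
        exact measure_mono (sUnion_subset fun V hV => (hS₀ V hV).2) }
  obtain ⟨f, hf0, hf⟩ := exists_seq_of_step
    (σ := Set (Set (ι → ℝ)) × ((ι → ℝ) → κ → ℝ) × ((ι → ℝ) → Matrix κ ι ℝ))
    (P := fun j s => IsStage A b Ω (𝓑 j) (c j) s.1 s.2.1 s.2.2)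
    (Q := fun j s s' => IsStep Ω K' (r j) (e j) ((1 / 2) ^ j) α s.1 s.2.1 s.2.2 s'.1 s'.2.1 s'.2.2)
    (s₀ := (𝒮₀, lmap A b, fun _ => A)) h0 fun j s hs => by
      obtain ⟨𝒮', U', G', h1, h2⟩ :=
        hs.exists_step hΩfin (h𝓑 j) (hq j) (he j) (δ := (1 / 2) ^ j) (by positivity) hα
      exact ⟨(𝒮', U', G'), by rw [hc]; exact h1, h2⟩
  choose 𝒟 h1 h2 h3 h4 h5 h6 using fun j => (hf j).2.done
  refine ⟨fun j => ⋃₀ (f j).1, 𝒟, fun j => (f j).2.1, fun j => (f j).2.2, ?_⟩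
  exact
    { start := by rw [hf0]
      measurableSet := fun j => .sUnion (hf j).1.countable fun V hV =>
        ((hf j).1.piece V hV).1.isOpen.measurableSet
      subset := fun j => sUnion_subset fun V hV => ((hf j).1.piece V hV).2.1
      anti := antitone_nat_of_succ_le fun j => (hf j).2.subset
      full := by rw [hf0]; exact hS₀v
      weak := fun j => (hf j).1.weak
      boundary := fun j => (hf j).1.boundary
      vol := fun j => (hf j).1.vol
      eq_off := fun j => (hf j).2.eq_off
      bound := fun j => (hf j).2.bound
      countable := h1
      piece := h2
      disj := h3
      disj_next := h4
      cover := h5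
      err := h6
      small := fun j => (hf j).2.small
      holder := fun j => (hf j).2.holder }

end

section

variable [Fintype ι] [Fintype κ]

theorem frobNorm_le {X : Matrix κ ι ℝ} {m : ℝ} (hm : 0 ≤ m) (hX : ∀ k i, |X k i| ≤ m) :
    frobNorm X ≤ (Fintype.card κ * Fintype.card ι : ℕ) * m := by
  refine Real.sqrt_le_iff.2 ⟨by positivity, ?_⟩
  calc ∑ k, ∑ i, X k i ^ 2 ≤ ∑ _k : κ, ∑ _i : ι, m ^ 2 :=
        Finset.sum_le_sum fun k _ => Finset.sum_le_sum fun i _ =>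
          sq_le_sq.2 (by rw [abs_of_nonneg hm]; exact hX k i)
    _ = (Fintype.card κ * Fintype.card ι : ℕ) * m ^ 2 := by
        simp [mul_assoc]
    _ ≤ (Fintype.card κ * Fintype.card ι : ℕ) ^ 2 * m ^ 2 := by
        refine mul_le_mul_of_nonneg_right ?_ (sq_nonneg m)
        exact_mod_cast Nat.le_self_pow two_ne_zero _
    _ = _ := by ring

theorem abs_le_frobNorm (X : Matrix κ ι ℝ) (k : κ) (i : ι) : |X k i| ≤ frobNorm X := by
  refine Real.abs_le_sqrt ?_
  calc X k i ^ 2 ≤ ∑ i, X k i ^ 2 :=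
        Finset.single_le_sum (f := fun i => X k i ^ 2) (fun i _ => sq_nonneg _) (Finset.mem_univ i)
    _ ≤ ∑ k, ∑ i, X k i ^ 2 :=
        Finset.single_le_sum (f := fun k => ∑ i, X k i ^ 2)
          (fun k _ => Finset.sum_nonneg fun i _ => sq_nonneg _) (Finset.mem_univ k)

theorem frobNorm_nonneg (X : Matrix κ ι ℝ) : 0 ≤ frobNorm X := Real.sqrt_nonneg _

variable [DecidableEq ι]

theorem HasWeakGradientOn.of_tendsto {U : ℕ → (ι → ℝ) → κ → ℝ} {G : ℕ → (ι → ℝ) → Matrix κ ι ℝ}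
    {u : (ι → ℝ) → κ → ℝ} {g : (ι → ℝ) → Matrix κ ι ℝ} {Ω : Set (ι → ℝ)}
    (h : ∀ j, HasWeakGradientOn (U j) (G j) Ω) {Φ Ψ : (ι → ℝ) → ℝ} (hΦ : IntegrableOn Φ Ω)
    (hΨ : IntegrableOn Ψ Ω) (hUΦ : ∀ j k, ∀ᵐ x ∂volume.restrict Ω, |U j x k| ≤ Φ x)
    (hGΨ : ∀ j k i, ∀ᵐ x ∂volume.restrict Ω, |G j x k i| ≤ Ψ x)
    (hu : ∀ k, ∀ᵐ x ∂volume.restrict Ω, Tendsto (fun j => U j x k) atTop (𝓝 (u x k)))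
    (hg : ∀ k i, ∀ᵐ x ∂volume.restrict Ω, Tendsto (fun j => G j x k i) atTop (𝓝 (g x k i))) :
    HasWeakGradientOn u g Ω := by
  have hUk : ∀ j k, IntegrableOn (fun x => U j x k) Ω := fun j k => (h j).integrable.eval k
  have hlim : ∀ {F : ℕ → (ι → ℝ) → ℝ} {f B : (ι → ℝ) → ℝ}, (∀ j, IntegrableOn (F j) Ω) →
      IntegrableOn B Ω → (∀ j, ∀ᵐ x ∂volume.restrict Ω, |F j x| ≤ B x) →
      (∀ᵐ x ∂volume.restrict Ω, Tendsto (fun j => F j x) atTop (𝓝 (f x))) →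
      IntegrableOn f Ω := fun {F f B} hF hB hFB hf => by
    refine Integrable.mono hB (aestronglyMeasurable_of_tendsto_ae atTop (fun j => (hF j).1) hf) ?_
    filter_upwards [hf, ae_all_iff.2 hFB] with x hx hx'
    refine (le_of_tendsto hx.norm (Eventually.of_forall hx')).trans (le_abs_self _)
  refine ⟨Integrable.of_eval fun k => hlim (fun j => hUk j k) hΦ (fun j => hUΦ j k) (hu k),
    fun k i => hlim (fun j => (h j).integrable_grad k i) hΨ (fun j => hGΨ j k i) (hg k i),
    fun φ hφ hφc hφs k i => ?_⟩
  obtain ⟨C, hC⟩ := (hφ 0).continuous.bounded_above_of_compact_support hφc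
  obtain ⟨C', hC'⟩ := exists_bound_fderiv hφ hφc (Pi.single i 1)
  have e1 := tendsto_integral_of_dominated_convergence (μ := volume.restrict Ω)
    (F := fun j x => U j x k * fderiv ℝ φ x (Pi.single i 1))
    (f := fun x => u x k * fderiv ℝ φ x (Pi.single i 1)) (fun x => Φ x * C')
    (fun j => (integrable_mul_fderiv (hUk j k) hφ hφc _).1) (hΦ.mul_const C')
    (fun j => by
      filter_upwards [hUΦ j k] with x hx
      rw [norm_mul]
      exact mul_le_mul hx (hC' x) (norm_nonneg _) ((abs_nonneg _).trans hx))
    (by filter_upwards [hu k] with x hx using hx.mul_const _)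
  have e2 := tendsto_integral_of_dominated_convergence (μ := volume.restrict Ω)
    (F := fun j x => G j x k i * φ x) (f := fun x => g x k i * φ x) (fun x => Ψ x * C)
    (fun j => (integrable_mul_test ((h j).integrable_grad k i) hφ hφc).1) (hΨ.mul_const C)
    (fun j => by
      filter_upwards [hGΨ j k i] with x hx
      rw [norm_mul]
      exact mul_le_mul hx (hC x) (norm_nonneg _) ((abs_nonneg _).trans hx))
    (by filter_upwards [hg k i] with x hx using hx.mul_const _)
  refine tendsto_nhds_unique e1 ?_
  simp only [fun j => (h j).parts φ hφ hφc hφs k i]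
  exact e2.neg

end

namespace IsScheme

variable [Fintype ι] [DecidableEq ι] [Fintype κ] {A : Matrix κ ι ℝ} {b : κ → ℝ}
  {Ω : Set (ι → ℝ)} {K' : Set (Matrix κ ι ℝ)} {c r e : ℕ → ℝ} {α : ℝ} {E : ℕ → Set (ι → ℝ)}
  {𝒟 : ℕ → Set (Set (ι → ℝ))} {U : ℕ → (ι → ℝ) → κ → ℝ} {G : ℕ → (ι → ℝ) → Matrix κ ι ℝ}

theorem eq_of_notMem (hs : IsScheme A b Ω K' c r e α E 𝒟 U G) {j : ℕ} {x : ι → ℝ} (hx : x ∉ E j)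
    {n : ℕ} (hn : j ≤ n) : U n x = U j x ∧ G n x = G j x := by
  induction n, hn using Nat.le_induction with
  | base => exact ⟨rfl, rfl⟩
  | succ n hn ih =>
    obtain ⟨h1, h2⟩ := hs.eq_off n x fun h => hx (hs.anti hn h)
    exact ⟨h1.trans ih.1, h2.trans ih.2⟩

theorem notMem_of_mem_done (hs : IsScheme A b Ω K' c r e α E 𝒟 U G) {j : ℕ} {x : ι → ℝ}
    (hx : x ∈ ⋃₀ 𝒟 j) : x ∉ E (j + 1) :=
  fun h => Set.disjoint_left.1 (hs.disj_next j) h hx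

theorem mem_of_mem_done (hs : IsScheme A b Ω K' c r e α E 𝒟 U G) {j : ℕ} {x : ι → ℝ}
    (hx : x ∈ ⋃₀ 𝒟 j) : x ∈ E j := by
  obtain ⟨D, hD, hxD⟩ := hx
  exact (hs.piece j D hD).2.1 hxD

theorem volume_diff_done (hs : IsScheme A b Ω K' c r e α E 𝒟 U G) (hΩ : volume Ω ≠ ⊤)
    (hc : Tendsto c atTop (𝓝 0)) : volume (Ω \ ⋃ j, ⋃₀ 𝒟 j) = 0 := by
  have hinter : volume (⋂ j, E j) = 0 := by
    have h1 : Tendsto (fun j => ENNReal.ofReal (c j) * volume Ω) atTop (𝓝 0) := by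
      have := ENNReal.Tendsto.mul_const (b := volume Ω) (ENNReal.tendsto_ofReal hc) (Or.inr hΩ)
      simpa using this
    exact le_antisymm (ge_of_tendsto' h1 fun j => (measure_mono (iInter_subset _ j)).trans
      (hs.vol j)) zero_le
  refine measure_mono_null (t := (Ω \ E 0) ∪ ((⋂ j, E j) ∪
    ⋃ j, (E j \ (E (j + 1) ∪ ⋃₀ 𝒟 j)))) ?_ (measure_union_null hs.full
      (measure_union_null hinter (measure_iUnion_null hs.cover)))
  rintro x ⟨hxΩ, hx⟩
  by_contra hc
  simp only [mem_union, not_or, Set.mem_sdiff, not_and, not_not, mem_iUnion, mem_iInter,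
    not_exists] at hc hx
  exact hc.2.1 fun j => by
    induction j with
    | zero => exact hc.1 hxΩ
    | succ j ih => exact by_contra fun h => hx j (hc.2.2 j ih h)

theorem exists_limit (hs : IsScheme A b Ω K' c r e α E 𝒟 U G) :
    ∃ (u : (ι → ℝ) → κ → ℝ) (g : (ι → ℝ) → Matrix κ ι ℝ),
      (∀ x, Tendsto (fun j => U j x) atTop (𝓝 (u x))) ∧
      ∀ j, ∀ x ∉ E j, u x = U j x ∧ g x = G j x := by
  classical
  have hcau : ∀ x, ∃ y, Tendsto (fun j => U j x) atTop (𝓝 y) := fun x =>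
    cauchySeq_tendsto_of_complete (cauchySeq_of_le_geometric (1 / 2) 1 (by norm_num) fun j => by
      rw [one_mul, dist_comm, dist_eq_norm]
      exact hs.small j x)
  choose u hu using hcau
  refine ⟨u, fun x => if h : ∃ j, x ∉ E j then G (Nat.find h) x else 0, hu, fun j x hx => ⟨?_, ?_⟩⟩
  · refine tendsto_nhds_unique (hu x) (tendsto_const_nhds.congr' ?_)
    filter_upwards [eventually_ge_atTop j] with n hn using (hs.eq_of_notMem hx hn).1.symm
  · have h : ∃ j, x ∉ E j := ⟨j, hx⟩
    change (if h : ∃ j, x ∉ E j then G (Nat.find h) x else 0) = G j x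
    rw [dif_pos h]
    exact (hs.eq_of_notMem (Nat.find_spec h) (Nat.find_min' h hx)).2.symm

theorem norm_sub_lmap_le (hs : IsScheme A b Ω K' c r e α E 𝒟 U G) (j : ℕ) (x : ι → ℝ) :
    ‖U j x - lmap A b x‖ ≤ 2 := by
  have h : ∀ j, dist (U j x) (U (j + 1) x) ≤ 1 * (1 / 2) ^ j := fun j => by
    rw [one_mul, dist_comm, dist_eq_norm]
    exact hs.small j x
  have h2 : dist (U 0 x) (U j x) ≤ ∑ i ∈ Finset.range j, (1 / 2 : ℝ) ^ i := by
    refine (dist_le_range_sum_dist (fun i => U i x) j).trans (Finset.sum_le_sum fun i _ => ?_)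
    simpa using h i
  rw [hs.start, dist_comm, dist_eq_norm] at h2
  refine h2.trans ?_
  have : (0 : ℝ) ≤ (1 / 2) ^ j := by positivity
  rw [geom_sum_eq (by norm_num), div_le_iff_of_neg (by norm_num)]
  linarith

theorem dist_limit_sub_le (hs : IsScheme A b Ω K' c r e α E 𝒟 U G) {u : (ι → ℝ) → κ → ℝ}
    (hu : ∀ x, Tendsto (fun j => U j x) atTop (𝓝 (u x))) (x y : ι → ℝ) :
    dist (u x) (u y) ≤ dist (lmap A b x) (lmap A b y) + 2 * dist x y ^ α := by
  have h : ∀ j, dist (U j x - U j y) (U (j + 1) x - U (j + 1) y) ≤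
      dist x y ^ α * (1 / 2) ^ j := fun j => by
    have := hs.holder j x y
    rw [dist_eq_norm] at this
    rw [dist_comm, dist_eq_norm, mul_comm]
    refine le_of_eq_of_le ?_ this
    congr 1
    abel
  have h2 := dist_le_of_le_geometric_of_tendsto₀ (1 / 2 : ℝ) _ (by norm_num) h
    ((hu x).sub (hu y))
  rw [hs.start, dist_comm, dist_eq_norm] at h2
  rw [dist_eq_norm, dist_eq_norm]
  have h3 := norm_le_norm_add_norm_sub' (u x - u y) (lmap A b x - lmap A b y)
  have h4 : dist x y ^ α / (1 - 1 / 2) = 2 * dist x y ^ α := by ring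
  linarith

theorem isPiecewiseAffineOn (hs : IsScheme A b Ω K' c r e α E 𝒟 U G) (hΩ : volume Ω ≠ ⊤)
    (hc : Tendsto c atTop (𝓝 0)) {u : (ι → ℝ) → κ → ℝ}
    (hu : ∀ j, ∀ x ∉ E j, u x = U j x) : IsPiecewiseAffineOn u Ω := by
  refine ⟨{D ∈ ⋃ j, 𝒟 j | D.Nonempty}, (countable_iUnion hs.countable).mono fun D h => h.1,
    ?_, ?_, ?_⟩
  · rintro D ⟨hD, hne⟩
    obtain ⟨j, hj⟩ := mem_iUnion.1 hD
    obtain ⟨h1, h2, B, d, h3⟩ := hs.piece j D hj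
    refine ⟨h1.isRegularDomain hne, h2.trans (hs.subset j), B, d, fun x hx => ?_⟩
    rw [hu (j + 1) x (hs.notMem_of_mem_done ⟨D, hj, hx⟩), h3 x hx]
  · have key : ∀ i j, i < j → ∀ D ∈ 𝒟 i, ∀ D' ∈ 𝒟 j, Disjoint D D' := by
      intro i j hij D hD D' hD'
      refine Set.disjoint_left.2 fun x hx hx' => hs.notMem_of_mem_done ⟨D, hD, hx⟩ ?_
      exact hs.anti hij (hs.mem_of_mem_done ⟨D', hD', hx'⟩)
    rintro D ⟨hD, -⟩ D' ⟨hD', -⟩ hne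
    obtain ⟨i, hi⟩ := mem_iUnion.1 hD
    obtain ⟨j, hj⟩ := mem_iUnion.1 hD'
    rcases lt_trichotomy i j with h | rfl | h
    · exact key i j h D hi D' hj
    · exact hs.disj i hi hj hne
    · exact (key j i h D' hj D hi).symm
  · refine measure_mono_null ?_ (hs.volume_diff_done hΩ hc)
    rintro x ⟨hxΩ, hx⟩
    refine ⟨hxΩ, fun h => hx ?_⟩
    obtain ⟨j, D, hD, hxD⟩ := mem_iUnion.1 h
    exact ⟨D, ⟨mem_iUnion.2 ⟨j, hD⟩, x, hxD⟩, hxD⟩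

theorem ae_exists_done (hs : IsScheme A b Ω K' c r e α E 𝒟 U G) (hΩ : volume Ω ≠ ⊤)
    (hΩm : MeasurableSet Ω) (hc : Tendsto c atTop (𝓝 0)) :
    ∀ᵐ x ∂volume.restrict Ω, ∃ j, x ∈ ⋃₀ 𝒟 j := by
  filter_upwards [ae_restrict_mem hΩm,
    ae_restrict_of_ae (measure_eq_zero_iff_ae_notMem.1 (hs.volume_diff_done hΩ hc))] with x hx hx'
  by_contra hn
  exact hx' ⟨hx, fun h => hn (mem_iUnion.1 h)⟩

theorem abs_grad_le (hs : IsScheme A b Ω K' c r e α E 𝒟 U G) {j : ℕ} {x : ι → ℝ}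
    (hx : x ∈ ⋃₀ 𝒟 j) (n : ℕ) (k : κ) (i : ι) :
    ∃ m, x ∈ E m ∧ |G n x k i| ≤ r m + 1 := by
  rcases le_or_gt n j with h | h
  · have hxn := hs.anti h (hs.mem_of_mem_done hx)
    exact ⟨n, hxn, (hs.bound n x hxn k i).1⟩
  · have hxj := hs.mem_of_mem_done hx
    rw [(hs.eq_of_notMem (hs.notMem_of_mem_done hx) h).2]
    exact ⟨j, hxj, (hs.bound j x hxj k i).2⟩

theorem hasWeakGradientOn (hs : IsScheme A b Ω K' c r e α E 𝒟 U G)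
    (hΩb : Bornology.IsBounded Ω) (hΩm : MeasurableSet Ω) (hc : Tendsto c atTop (𝓝 0))
    (hc0 : ∀ j, 0 ≤ c j) (hr : ∀ j, 0 ≤ r j) (hsum : Summable fun j => c j * (r j + 1))
    {u : (ι → ℝ) → κ → ℝ} {g : (ι → ℝ) → Matrix κ ι ℝ}
    (hu : ∀ x, Tendsto (fun j => U j x) atTop (𝓝 (u x)))
    (hg : ∀ j, ∀ x ∉ E j, g x = G j x) : HasWeakGradientOn u g Ω := by
  have hΩ : volume Ω ≠ ⊤ := hΩb.measure_lt_top.ne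
  let Θ : (ι → ℝ) → ENNReal := fun x => ∑' j, (E j).indicator (fun _ => ENNReal.ofReal (r j + 1)) x
  have hΘm : Measurable Θ :=
    Measurable.tsum fun j => measurable_const.indicator (hs.measurableSet j)
  have hΘ : ∫⁻ x, Θ x ≠ ⊤ := by
    have h1 : ∫⁻ x, Θ x ≤ ∑' j, ENNReal.ofReal (c j * (r j + 1)) * volume Ω := by
      rw [lintegral_tsum fun j => (measurable_const.indicator (hs.measurableSet j)).aemeasurable]
      refine ENNReal.tsum_le_tsum fun j => ?_
      rw [lintegral_indicator_const (hs.measurableSet j), mul_comm (c j),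
        ENNReal.ofReal_mul (by linarith [hr j]), mul_assoc]
      gcongr
      exact hs.vol j
    refine (h1.trans_lt ?_).ne
    rw [ENNReal.tsum_mul_right]
    refine ENNReal.mul_lt_top ?_ hΩ.lt_top
    rw [← ENNReal.ofReal_tsum_of_nonneg
      (fun j => mul_nonneg (hc0 j) (by linarith [hr j])) hsum]
    exact ENNReal.ofReal_lt_top
  obtain ⟨C, hC⟩ : ∃ C, ∀ x ∈ Ω, ‖lmap A b x‖ ≤ C := by
    have hcl : IsCompact (closure Ω) :=
      Metric.isCompact_of_isClosed_isBounded isClosed_closure hΩb.closure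
    obtain ⟨C, hC⟩ := hcl.exists_bound_of_continuousOn (continuous_lmap A b).continuousOn
    exact ⟨C, fun x hx => hC x (subset_closure hx)⟩
  have hdone := hs.ae_exists_done hΩ hΩm hc
  refine HasWeakGradientOn.of_tendsto hs.weak (Φ := fun _ => C + 2) (Ψ := fun x => (Θ x).toReal)
    (integrableOn_const hΩ) (integrable_toReal_of_lintegral_ne_top hΘm.aemeasurable hΘ).integrableOn
    (fun j k => ?_) (fun j k i => ?_) (fun k => Eventually.of_forall fun x => ?_) fun k i => ?_
  · filter_upwards [ae_restrict_mem hΩm] with x hx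
    refine (norm_le_pi_norm (U j x) k).trans ?_
    have := norm_le_norm_add_norm_sub' (U j x) (lmap A b x)
    linarith [hC x hx, hs.norm_sub_lmap_le j x]
  · filter_upwards [hdone, ae_restrict_of_ae (ae_lt_top hΘm hΘ)] with x ⟨m, hm⟩ hx
    obtain ⟨l, hl, hG⟩ := hs.abs_grad_le hm j k i
    refine hG.trans ((ENNReal.ofReal_le_iff_le_toReal hx.ne).1 ?_)
    refine le_trans ?_ (ENNReal.le_tsum l)
    rw [indicator_of_mem hl]
  · exact ((continuous_apply k).tendsto (u x)).comp (hu x)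
  · filter_upwards [hdone] with x ⟨m, hm⟩
    refine tendsto_const_nhds.congr' ?_
    filter_upwards [eventually_ge_atTop (m + 1)] with n hn
    have hx := hs.notMem_of_mem_done hm
    rw [hg _ x hx, (hs.eq_of_notMem hx hn).2]

end IsScheme

theorem exists_dist_lmap_le [Fintype ι] [Fintype κ] (A : Matrix κ ι ℝ) (b : κ → ℝ) :
    ∃ C, 0 ≤ C ∧ ∀ x y, dist (lmap A b x) (lmap A b y) ≤ C * dist x y := by
  refine ⟨∑ k, ∑ i, |A k i|, by positivity, fun x y => ?_⟩
  refine (dist_pi_le_iff (by positivity)).2 fun k => ?_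
  have h : lmap A b x k - lmap A b y k = ∑ i, A k i * (x i - y i) := by
    simp only [lmap, mul_sub, Finset.sum_sub_distrib]
    ring
  rw [Real.dist_eq, h]
  calc |∑ i, A k i * (x i - y i)| ≤ ∑ i, |A k i| * dist x y :=
        (Finset.abs_sum_le_sum_abs _ _).trans (Finset.sum_le_sum fun i _ => by
          rw [abs_mul]
          gcongr
          exact (Real.dist_eq _ _).symm.trans_le (dist_le_pi_dist x y i))
    _ = (∑ i, |A k i|) * dist x y := by rw [Finset.sum_mul]
    _ ≤ _ := by
        gcongr
        exact Finset.single_le_sum (f := fun k => ∑ i, |A k i|)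
          (fun k _ => Finset.sum_nonneg fun i _ => abs_nonneg _) (Finset.mem_univ k)

theorem memHolder_of_dist_le [Fintype ι] [Fintype κ] {A : Matrix κ ι ℝ} {b : κ → ℝ}
    {u : (ι → ℝ) → κ → ℝ} {α : ℝ} (hα : α ∈ Ioo (0 : ℝ) 1)
    (hu : ∀ x y, dist (u x) (u y) ≤ dist (lmap A b x) (lmap A b y) + 2 * dist x y ^ α)
    {S : Set (ι → ℝ)} (hS : Bornology.IsBounded S) : MemHolder α S u := by
  obtain ⟨C, hC0, hC⟩ := exists_dist_lmap_le A b
  constructor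
  · refine Continuous.continuousOn (continuous_iff_continuousAt.2 fun x => ?_)
    refine tendsto_iff_dist_tendsto_zero.2 (squeeze_zero (fun _ => dist_nonneg)
      (g := fun y => C * dist y x + 2 * dist y x ^ α) (fun y => ?_) ?_)
    · exact (hu y x).trans (by linarith [hC y x])
    · have h : Continuous fun y : ι → ℝ => C * dist y x + 2 * dist y x ^ α := by
        have : Continuous fun y : ι → ℝ => dist y x ^ α :=
          (continuous_id.dist continuous_const).rpow_const fun _ => Or.inr hα.1.le
        fun_prop
      have h2 := h.tendsto x
      simpa [Real.zero_rpow hα.1.ne'] using h2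
  · refine ⟨C * Metric.diam S ^ (1 - α) + 2, fun x hx y hy => (hu x y).trans ?_⟩
    have h1 : dist x y ≤ Metric.diam S ^ (1 - α) * dist x y ^ α := by
      rcases eq_or_lt_of_le (dist_nonneg (x := x) (y := y)) with h | h
      · rw [← h]
        positivity
      · calc dist x y = dist x y ^ (1 - α) * dist x y ^ α := by
              rw [← Real.rpow_add h, sub_add_cancel, Real.rpow_one]
          _ ≤ _ := by
              gcongr
              · linarith [hα.2]
              · exact Metric.dist_le_diam_of_mem hS hx hy
    have h2 := (hC x y).trans (mul_le_mul_of_nonneg_left h1 hC0)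
    rw [add_mul, mul_assoc]
    linarith

namespace IsScheme

variable [Fintype ι] [DecidableEq ι] [Fintype κ] {A : Matrix κ ι ℝ} {b : κ → ℝ}
  {Ω : Set (ι → ℝ)} {K' : Set (Matrix κ ι ℝ)} {c r e R : ℕ → ℝ} {α : ℝ} {E : ℕ → Set (ι → ℝ)}
  {𝒟 : ℕ → Set (Set (ι → ℝ))} {U : ℕ → (ι → ℝ) → κ → ℝ} {G : ℕ → (ι → ℝ) → Matrix κ ι ℝ}

theorem frobNorm_limit_le (hs : IsScheme A b Ω K' c r e α E 𝒟 U G) (hr : ∀ j, 0 ≤ r j)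
    (hR : ∀ j, (Fintype.card κ * Fintype.card ι : ℕ) * (r j + 1) ≤ R j)
    {g : (ι → ℝ) → Matrix κ ι ℝ} (hg : ∀ j, ∀ x ∉ E j, g x = G j x) {j : ℕ} {x : ι → ℝ}
    (hx : x ∈ ⋃₀ 𝒟 j) : frobNorm (g x) ≤ R j := by
  rw [hg _ x (hs.notMem_of_mem_done hx)]
  exact (frobNorm_le (by linarith [hr j])
    fun k i => (hs.bound j x (hs.mem_of_mem_done hx) k i).2).trans (hR j)

theorem lintegral_error_le (hs : IsScheme A b Ω K' c r e α E 𝒟 U G) (hΩ : volume Ω ≠ ⊤)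
    (hc : Tendsto c atTop (𝓝 0)) (hr : ∀ j, 0 ≤ r j)
    (hR : ∀ j, (Fintype.card κ * Fintype.card ι : ℕ) * (r j + 1) ≤ R j)
    {g : (ι → ℝ) → Matrix κ ι ℝ} (hg : ∀ j, ∀ x ∉ E j, g x = G j x) {s : ℝ} (hs0 : 0 ≤ s) :
    ∫⁻ x in {x ∈ Ω | g x ∉ K'}, ENNReal.ofReal ((1 + frobNorm (g x)) ^ s) ≤
      ∑' j, ENNReal.ofReal ((1 + R j) ^ s) * (ENNReal.ofReal (e j) * volume Ω) := by
  set N := Ω \ ⋃ j, ⋃₀ 𝒟 j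
  set F : ℕ → Set (ι → ℝ) := fun j => {x ∈ ⋃₀ 𝒟 j | G (j + 1) x ∉ K'} with hF
  have hsub : {x ∈ Ω | g x ∉ K'} ⊆ N ∪ ⋃ j, F j := by
    rintro x ⟨hx, hgx⟩
    by_cases h : x ∈ ⋃ j, ⋃₀ 𝒟 j
    · obtain ⟨j, hj⟩ := mem_iUnion.1 h
      refine Or.inr (mem_iUnion.2 ⟨j, hj, ?_⟩)
      rwa [← hg _ x (hs.notMem_of_mem_done hj)]
    · exact Or.inl ⟨hx, h⟩
  have hmeas : ∀ j, MeasurableSet (⋃₀ 𝒟 j) := fun j =>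
    (isOpen_sUnion fun D hD => (hs.piece j D hD).1.isOpen).measurableSet
  calc _ ≤ ∫⁻ x in N ∪ ⋃ j, F j, ENNReal.ofReal ((1 + frobNorm (g x)) ^ s) :=
        lintegral_mono_set hsub
    _ ≤ (∫⁻ x in N, ENNReal.ofReal ((1 + frobNorm (g x)) ^ s)) +
        ∫⁻ x in ⋃ j, F j, ENNReal.ofReal ((1 + frobNorm (g x)) ^ s) := lintegral_union_le _ _ _
    _ ≤ 0 + ∑' j, ∫⁻ x in F j, ENNReal.ofReal ((1 + frobNorm (g x)) ^ s) := by
        refine add_le_add (le_of_eq ?_) (lintegral_iUnion_le _ _)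
        exact setLIntegral_measure_zero _ _ (hs.volume_diff_done hΩ hc)
    _ ≤ _ := by
        rw [zero_add]
        refine ENNReal.tsum_le_tsum fun j => ?_
        have h1 : ∀ᵐ x ∂volume.restrict (F j), ENNReal.ofReal ((1 + frobNorm (g x)) ^ s) ≤
            ENNReal.ofReal ((1 + R j) ^ s) := by
          have h2 : ∀ᵐ x ∂volume.restrict (F j), x ∈ ⋃₀ 𝒟 j :=
            ae_restrict_of_ae_restrict_of_subset (fun x hx => hx.1) (ae_restrict_mem (hmeas j))
          filter_upwards [h2] with x hx
          have h3 := frobNorm_nonneg (g x)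
          have h4 := hs.frobNorm_limit_le hr hR hg hx
          gcongr
        refine (lintegral_mono_ae h1).trans ?_
        rw [lintegral_const, Measure.restrict_apply_univ]
        gcongr
        exact hs.err j

theorem volume_lt_frobNorm_le (hs : IsScheme A b Ω K' c r e α E 𝒟 U G) (hΩ : volume Ω ≠ ⊤)
    (hc : Tendsto c atTop (𝓝 0)) (hr : ∀ j, 0 ≤ r j)
    (hR : ∀ j, (Fintype.card κ * Fintype.card ι : ℕ) * (r j + 1) ≤ R j)
    {g : (ι → ℝ) → Matrix κ ι ℝ} (hg : ∀ j, ∀ x ∉ E j, g x = G j x) {p C : ℝ} (hp : 0 ≤ p)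
    (hc0 : ∀ j, 0 ≤ c j) (hC : ∀ j, c j * R j ^ p ≤ C) {t : ℝ} (ht : 0 < t) :
    volume {x ∈ Ω | t < frobNorm (g x)} ≤ ENNReal.ofReal (C * t ^ (-p)) * volume Ω := by
  classical
  set N := Ω \ ⋃ j, ⋃₀ 𝒟 j
  have hN : volume N = 0 := hs.volume_diff_done hΩ hc
  by_cases h : ∃ j, t < R j
  · have h0 := Nat.find_spec h
    have hsub : {x ∈ Ω | t < frobNorm (g x)} ⊆ N ∪ E (Nat.find h) := by
      rintro x ⟨hx, htx⟩
      by_cases hd : x ∈ ⋃ j, ⋃₀ 𝒟 j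
      · obtain ⟨j, hj⟩ := mem_iUnion.1 hd
        exact Or.inr (hs.anti (Nat.find_min' h (htx.trans_le (hs.frobNorm_limit_le hr hR hg hj)))
          (hs.mem_of_mem_done hj))
      · exact Or.inl ⟨hx, hd⟩
    refine (measure_mono hsub).trans ((measure_union_le _ _).trans ?_)
    rw [hN, zero_add]
    refine (hs.vol _).trans ?_
    gcongr
    have h1 : t ^ p ≤ R (Nat.find h) ^ p := Real.rpow_le_rpow ht.le h0.le hp
    have h2 := mul_le_mul_of_nonneg_left h1 (hc0 (Nat.find h))
    rw [Real.rpow_neg ht.le, ← div_eq_mul_inv, le_div_iff₀ (Real.rpow_pos_of_pos ht p)]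
    exact h2.trans (hC _)
  · push Not at h
    refine le_of_eq_of_le (measure_mono_null (t := N) ?_ hN) zero_le
    rintro x ⟨hx, htx⟩
    refine ⟨hx, fun hd => ?_⟩
    obtain ⟨j, hj⟩ := mem_iUnion.1 hd
    linarith [h j, hs.frobNorm_limit_le hr hR hg hj]

end IsScheme

/-- If `A` is the start of a sequence of splitting classes whose remaining volume fractions `c`
and gradient bounds `R` satisfy `c j * R j ^ p ≤ C`, then `A` is a boundary value for an
approximate solution of `∇u ∈ K'` with a weak `L^p` bound. -/
theorem exists_map_of_splits [Fintype ι] [DecidableEq ι] [Fintype κ] {A : Matrix κ ι ℝ}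
    (b : κ → ℝ) {Ω : Set (ι → ℝ)} (hΩ : IsRegularDomain Ω) {K' : Set (Matrix κ ι ℝ)}
    {𝓑 : ℕ → Set (Matrix κ ι ℝ)} {c q r R : ℕ → ℝ} {α s p C ε : ℝ} (hα : α ∈ Ioo (0 : ℝ) 1)
    (hs0 : 0 ≤ s) (hp : 0 ≤ p) (hε : 0 < ε)
    (hA : A ∈ 𝓑 0) (hc0 : c 0 = 1) (hcq : ∀ j, c (j + 1) = q j * c j) (hq : ∀ j, 0 ≤ q j)
    (h𝓑 : ∀ j, ∀ B ∈ 𝓑 j, Splits B K' (𝓑 (j + 1)) (q j) (r j)) (hr : ∀ j, 0 ≤ r j)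
    (hR : ∀ j, (Fintype.card κ * Fintype.card ι : ℕ) * (r j + 1) ≤ R j)
    (hc : Tendsto c atTop (𝓝 0)) (hcpos : ∀ j, 0 ≤ c j)
    (hsum : Summable fun j => c j * (r j + 1)) (hC : ∀ j, c j * R j ^ p ≤ C) :
    ∃ (u : (ι → ℝ) → κ → ℝ) (G : (ι → ℝ) → Matrix κ ι ℝ),
        IsPiecewiseAffineOn u Ω ∧ HasWeakGradientOn u G Ω ∧ MemHolder α (closure Ω) u ∧
        (∀ x ∈ frontier Ω, u x = lmap A b x) ∧
        (∫ x in {x ∈ Ω | G x ∉ K'}, (1 + frobNorm (G x)) ^ s) < ε * (volume Ω).toReal ∧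
        ∀ t : ℝ, 0 < t →
          volume {x ∈ Ω | t < frobNorm (G x)} ≤ ENNReal.ofReal (C * t ^ (-p)) * volume Ω := by
  obtain ⟨hΩo, hΩb, hΩc, -⟩ := hΩ
  have hΩfin : volume Ω ≠ ⊤ := hΩb.measure_lt_top.ne
  have hΩpos : 0 < (volume Ω).toReal :=
    ENNReal.toReal_pos (hΩo.measure_pos volume hΩc.nonempty).ne' hΩfin
  have hR0 : ∀ j, 0 ≤ R j := fun j =>
    (mul_nonneg (Nat.cast_nonneg _) (by linarith [hr j])).trans (hR j)
  have hRs : ∀ j, 0 < (1 + R j) ^ s := fun j => Real.rpow_pos_of_pos (by linarith [hR0 j]) s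
  obtain ⟨E, 𝒟, U, G, hs⟩ := exists_isScheme (e := fun j => ε / 4 * (1 / 2) ^ j / (1 + R j) ^ s)
    b hΩo hΩb hα hA hc0 hcq hq (fun j => by have := hRs j; positivity) h𝓑
  obtain ⟨u, g, hu, hug⟩ := hs.exists_limit
  have hg : ∀ j, ∀ x ∉ E j, g x = G j x := fun j x hx => (hug j x hx).2
  refine ⟨u, g, hs.isPiecewiseAffineOn hΩfin hc fun j x hx => (hug j x hx).1,
    hs.hasWeakGradientOn hΩb hΩo.measurableSet hc hcpos hr hsum hu hg,
    memHolder_of_dist_le hα (hs.dist_limit_sub_le hu) hΩb.closure, fun x hx => ?_, ?_,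
    fun t ht => hs.volume_lt_frobNorm_le hΩfin hc hr hR hg hp hcpos hC ht⟩
  · have hx' : x ∉ Ω := fun h => hx.2 (hΩo.interior_eq.symm ▸ h)
    refine tendsto_nhds_unique (hu x) (tendsto_const_nhds.congr fun j => ?_)
    exact (hs.boundary j x hx').symm
  · have h1 := hs.lintegral_error_le hΩfin hc hr hR hg hs0
    have h2 : ∀ j, ENNReal.ofReal ((1 + R j) ^ s) *
        (ENNReal.ofReal (ε / 4 * (1 / 2) ^ j / (1 + R j) ^ s) * volume Ω) =
        ENNReal.ofReal (ε / 4 * (volume Ω).toReal * (1 / 2) ^ j) := fun j => by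
      rw [← mul_assoc, ← ENNReal.ofReal_mul (hRs j).le, mul_div_cancel₀ _ (hRs j).ne',
        mul_right_comm, ENNReal.ofReal_mul (q := (volume Ω).toReal) (by positivity),
        ENNReal.ofReal_toReal hΩfin]
    simp only [h2] at h1
    rw [← ENNReal.ofReal_tsum_of_nonneg (fun j => by positivity)
      (summable_geometric_two.mul_left _), tsum_mul_left, tsum_geometric_two] at h1
    have h3 : ‖∫ x in {x ∈ Ω | g x ∉ K'}, (1 + frobNorm (g x)) ^ s‖ ≤
        ε / 4 * (volume Ω).toReal * 2 := by
      refine (norm_integral_le_lintegral_norm _).trans ?_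
      refine ENNReal.toReal_le_of_le_ofReal (by positivity) (le_of_eq_of_le ?_ h1)
      refine lintegral_congr fun x => ?_
      rw [Real.norm_of_nonneg]
      have := frobNorm_nonneg (g x)
      positivity
    have h4 := (le_abs_self _).trans h3
    have h5 : 0 < ε * (volume Ω).toReal := mul_pos hε hΩpos
    linarith

section

theorem Splits.mono [Fintype ι] [DecidableEq ι] [Fintype κ] {B : Matrix κ ι ℝ}
    {K' 𝓑 𝓑' : Set (Matrix κ ι ℝ)} {q r : ℝ} (h : Splits B K' 𝓑 q r) (h𝓑 : 𝓑 ⊆ 𝓑') :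
    Splits B K' 𝓑' q r := by
  obtain ⟨a, i, l₁, l₂, h1, h2, h3, h4, h5⟩ := h
  exact ⟨a, i, l₁, l₂, h1, h2, h𝓑 h3, h4.imp_left (And.imp_left (@h𝓑 _)), h5⟩

theorem add_vecMulVec_col_apply [DecidableEq ι] (B : Matrix ι ι ℝ) (i : ι) (l : ℝ) (k j : ι) :
    (B + Matrix.vecMulVec (fun k => B k i) (Pi.single i l)) k j =
      if j = i then (1 + l) * B k j else B k j := by
  rw [Matrix.add_apply, Matrix.vecMulVec_apply]
  split_ifs with h
  · subst h
    rw [Pi.single_eq_same]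
    ring
  · rw [Pi.single_eq_of_ne h, mul_zero, add_zero]

variable [Fintype ι] [DecidableEq ι]

theorem two_pow_card_le_abs_det {B : Matrix ι ι ℝ} (hB : ∀ x, 2 * ‖x‖ ≤ ‖B.mulVec x‖) :
    2 ^ Fintype.card ι ≤ |B.det| := by
  have hinj : Function.Injective B.toLin' := by
    refine (injective_iff_map_eq_zero _).2 fun x hx => ?_
    have h := hB x
    rw [Matrix.toLin'_apply] at hx
    rw [hx, norm_zero] at h
    exact norm_le_zero_iff.1 (by linarith)
  have hsurj : Function.Surjective B.toLin' := LinearMap.injective_iff_surjective.1 hinj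
  have hsub : Metric.ball (0 : ι → ℝ) 2 ⊆ B.toLin' '' Metric.ball 0 1 := by
    intro y hy
    obtain ⟨x, rfl⟩ := hsurj y
    refine ⟨x, ?_, rfl⟩
    have h := hB x
    rw [mem_ball_zero_iff, Matrix.toLin'_apply] at hy
    rw [mem_ball_zero_iff]
    linarith
  have h := measure_mono (μ := volume) hsub
  rw [Measure.addHaar_image_linearMap, Measure.addHaar_ball_of_pos _ _ two_pos,
    LinearMap.det_toLin'] at h
  have h1 : volume (Metric.ball (0 : ι → ℝ) 1) ≠ 0 := (Metric.measure_ball_pos _ _ one_pos).ne'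
  have h2 : volume (Metric.ball (0 : ι → ℝ) 1) ≠ ⊤ := measure_ball_lt_top.ne
  rw [ENNReal.mul_le_mul_iff_left h1 h2, ENNReal.ofReal_le_ofReal_iff (abs_nonneg _),
    Module.finrank_fintype_fun_eq_card] at h
  exact h

/-- The matrices obtained from `A` by adding `±s` to the entries `(π i, i)`, for the first `j`
indices `i`. -/
def perturbClass (A : Matrix ι ι ℝ) (π : ι ≃ ι) (s : ℝ) (j : ℕ) : Set (Matrix ι ι ℝ) :=
  {B | (∀ k i, k ≠ π i → B k i = A k i) ∧
    ∀ i, ((Fintype.equivFin ι i : ℕ) < j → |B (π i) i - A (π i) i| = s) ∧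
      (j ≤ Fintype.equivFin ι i → B (π i) i = A (π i) i)}

/-- The matrices with support in `Z`, determinant at least `2 ^ (m + 1)` in modulus, and entries of
size `2 ^ (m / N)`, the columns being allowed to grow one after the other. -/
def stairClass (Z : ι → ι → Prop) (ρ : ℝ) (m : ℕ) : Set (Matrix ι ι ℝ) :=
  {B | (∀ k i, ¬ Z k i → B k i = 0) ∧ 2 ^ (m + 1) ≤ |B.det| ∧
    ∀ k i, |B k i| ≤ ρ * 2 ^ ((m + Fintype.equivFin ι i) / Fintype.card ι)}

variable {A B : Matrix ι ι ℝ} {π : ι ≃ ι} {Z : ι → ι → Prop} {s a ρ : ℝ}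

theorem abs_le_of_mem_perturbClass (hs : 0 ≤ s) (ha : ∀ k i, |A k i| ≤ a) {j : ℕ}
    (hB : B ∈ perturbClass A π s j) (k i : ι) : |B k i| ≤ a + s := by
  by_cases hk : k = π i
  · subst hk
    rcases lt_or_ge (Fintype.equivFin ι i : ℕ) j with h | h
    · have h1 := (hB.2 i).1 h
      have h2 := abs_add_le (B (π i) i - A (π i) i) (A (π i) i)
      rw [sub_add_cancel, h1] at h2
      linarith [ha (π i) i]
    · rw [(hB.2 i).2 h]
      linarith [ha (π i) i]
  · rw [hB.1 k i hk]
    linarith [ha k i]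

theorem add_mem_perturbClass {j : ℕ} (hB : B ∈ perturbClass A π s j) {i : ι}
    (hi : (Fintype.equivFin ι i : ℕ) = j) {t : ℝ} (ht : |t| = s) :
    B + Matrix.vecMulVec (Pi.single (π i) 1) (Pi.single i t) ∈ perturbClass A π s (j + 1) := by
  have hne : ∀ l, l ≠ i → (Fintype.equivFin ι l : ℕ) ≠ j := fun l hl h =>
    hl ((Fintype.equivFin ι).injective (Fin.ext (h.trans hi.symm)))
  refine ⟨fun k l hk => ?_, fun l => ?_⟩
  · rw [Matrix.add_apply, Matrix.vecMulVec_apply, hB.1 k l hk]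
    by_cases hl : l = i
    · subst hl
      rw [Pi.single_eq_of_ne hk, zero_mul, add_zero]
    · rw [Pi.single_eq_of_ne hl, mul_zero, add_zero]
  · rw [Matrix.add_apply, Matrix.vecMulVec_apply]
    by_cases hl : l = i
    · subst hl
      rw [Pi.single_eq_same, Pi.single_eq_same, (hB.2 l).2 hi.ge]
      refine ⟨fun _ => ?_, fun h => by omega⟩
      rw [one_mul, add_sub_cancel_left, ht]
    · rw [Pi.single_eq_of_ne hl, mul_zero, add_zero]
      have := hne l hl
      exact ⟨fun h => (hB.2 l).1 (by omega), fun h => (hB.2 l).2 (by omega)⟩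

theorem splits_of_mem_perturbClass {K' : Set (Matrix ι ι ℝ)} (hs : 0 < s)
    (ha : ∀ k i, |A k i| ≤ a) {j : ℕ} (hj : j < Fintype.card ι) (hB : B ∈ perturbClass A π s j)
    {q r : ℝ} (hq : 1 ≤ q) (hr : a + s ≤ r) : Splits B K' (perturbClass A π s (j + 1)) q r := by
  obtain ⟨i, hi⟩ := (Fintype.equivFin ι).surjective ⟨j, hj⟩
  have hi' : (Fintype.equivFin ι i : ℕ) = j := by rw [hi]
  have h1 := add_mem_perturbClass hB hi' (abs_of_pos hs)
  have h2 := add_mem_perturbClass hB hi' (t := -s) (by rw [abs_neg, abs_of_pos hs])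
  exact ⟨Pi.single (π i) 1, i, s, s, hs, hs, h1, Or.inl ⟨h2, hq⟩,
    fun k l => (abs_le_of_mem_perturbClass hs.le ha hB k l).trans hr,
    fun k l => (abs_le_of_mem_perturbClass hs.le ha h1 k l).trans hr,
    fun k l => (abs_le_of_mem_perturbClass hs.le ha h2 k l).trans hr⟩

theorem perturbClass_card_subset_stairClass [Nonempty ι] (hZ : ∀ i, Z (π i) i)
    (hA : ∀ k i, ¬ Z k i → A k i = 0) (ha : ∀ k i, |A k i| ≤ a)
    (hs : s = Fintype.card ι * a + 2) (hs0 : 0 ≤ s) (hρ : a + s ≤ ρ) :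
    perturbClass A π s (Fintype.card ι) ⊆ stairClass Z ρ 0 := by
  intro B hB
  refine ⟨fun k i hk => ?_, ?_, fun k i => ?_⟩
  · rw [hB.1 k i fun h => hk (h ▸ hZ i), hA k i hk]
  · have h1 : (2 : ℝ) ^ (0 + 1) ≤ 2 ^ Fintype.card ι :=
      pow_le_pow_right₀ one_le_two (by have := Fintype.card_pos (α := ι); omega)
    refine h1.trans (two_pow_card_le_abs_det fun x => ?_)
    obtain ⟨i, hi⟩ := exists_max_image univ (fun i => ‖x i‖) finite_univ univ_nonempty
    have hx : ‖x‖ = |x i| := le_antisymm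
      ((pi_norm_le_iff_of_nonneg (norm_nonneg _)).2 fun l => hi.2 l (mem_univ l))
      (norm_le_pi_norm x i)
    have h2 : B.mulVec x (π i) = A.mulVec x (π i) + (B (π i) i - A (π i) i) * x i := by
      simp only [Matrix.mulVec, dotProduct]
      rw [← sub_eq_iff_eq_add', ← Finset.sum_sub_distrib, Finset.sum_eq_single i]
      · ring
      · intro l _ hl
        rw [hB.1 (π i) l fun h => hl (π.injective h).symm, sub_self]
      · simp
    have h3 : |A.mulVec x (π i)| ≤ Fintype.card ι * a * ‖x‖ := by
      calc |A.mulVec x (π i)| ≤ ∑ l, |A (π i) l * x l| := Finset.abs_sum_le_sum_abs _ _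
        _ ≤ ∑ _l : ι, a * ‖x‖ := Finset.sum_le_sum fun l _ => by
            rw [abs_mul]
            exact mul_le_mul (ha _ _) (norm_le_pi_norm x l) (abs_nonneg _)
              ((abs_nonneg _).trans (ha (π i) l))
        _ = _ := by rw [Finset.sum_const, nsmul_eq_mul, Finset.card_univ, mul_assoc]
    have h4 : |(B (π i) i - A (π i) i) * x i| = s * ‖x‖ := by
      rw [abs_mul, (hB.2 i).1 (Fintype.equivFin ι i).isLt, hx]
    have h5 := norm_le_pi_norm (B.mulVec x) (π i)
    rw [h2, Real.norm_eq_abs] at h5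
    have h6 := abs_sub_abs_le_abs_add ((B (π i) i - A (π i) i) * x i) (A.mulVec x (π i))
    rw [add_comm, h4] at h6
    have h7 : s * ‖x‖ = Fintype.card ι * a * ‖x‖ + 2 * ‖x‖ := by rw [hs]; ring
    linarith
  · have h1 : (0 + (Fintype.equivFin ι i : ℕ)) / Fintype.card ι = 0 :=
      Nat.div_eq_of_lt (by have := (Fintype.equivFin ι i).isLt; omega)
    rw [h1, pow_zero, mul_one]
    exact (abs_le_of_mem_perturbClass hs0 ha hB k i).trans hρ

theorem det_add_vecMulVec_col (B : Matrix ι ι ℝ) (i : ι) (l : ℝ) :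
    (B + Matrix.vecMulVec (fun k => B k i) (Pi.single i l)).det = (1 + l) * B.det := by
  have h : B + Matrix.vecMulVec (fun k => B k i) (Pi.single i l) =
      B.updateCol i ((1 + l) • fun k => B k i) := by
    ext k j
    rw [add_vecMulVec_col_apply, Matrix.updateCol_apply]
    split_ifs with h
    · subst h
      rfl
    · rfl
  rw [h, Matrix.det_updateCol_smul, Matrix.updateCol_eq_self]

theorem abs_le_of_mem_stairClass (hρ : 0 ≤ ρ) {m : ℕ} (hB : B ∈ stairClass Z ρ m) (k i : ι) :
    |B k i| ≤ 2 * ρ * 2 ^ ((m : ℝ) / Fintype.card ι) := by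
  have hN : 0 < Fintype.card ι := Fintype.card_pos_iff.2 ⟨i⟩
  have h1 : (m + (Fintype.equivFin ι i : ℕ)) / Fintype.card ι ≤ m / Fintype.card ι + 1 := by
    rw [← Nat.add_div_right m hN]
    exact Nat.div_le_div_right (by have := (Fintype.equivFin ι i).isLt; omega)
  have h2 : (2 : ℝ) ^ (m / Fintype.card ι) ≤ 2 ^ ((m : ℝ) / Fintype.card ι) := by
    rw [← Real.rpow_natCast]
    exact Real.rpow_le_rpow_of_exponent_le one_le_two Nat.cast_div_le
  calc |B k i| ≤ ρ * 2 ^ ((m + Fintype.equivFin ι i) / Fintype.card ι) := hB.2.2 k i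
    _ ≤ ρ * 2 ^ (m / Fintype.card ι + 1) := by
        gcongr
        exact one_le_two
    _ = 2 * ρ * 2 ^ (m / Fintype.card ι) := by ring
    _ ≤ _ := by gcongr

theorem splits_of_mem_stairClass [Nonempty ι] (hρ : 0 ≤ ρ) {m : ℕ} (hB : B ∈ stairClass Z ρ m) :
    Splits B {X | (∀ k i, ¬ Z k i → X k i = 0) ∧ X.det = 1} (stairClass Z ρ (m + 1))
      ((2 ^ m + 2) / (2 ^ (m + 1) + 2)) (4 * ρ * 2 ^ ((m : ℝ) / Fintype.card ι)) := by
  have hN : 0 < Fintype.card ι := Fintype.card_pos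
  obtain ⟨i, hi⟩ : ∃ i, Fintype.card ι ∣ m + Fintype.equivFin ι i + 1 := by
    obtain ⟨i, hi⟩ := (Fintype.equivFin ι).surjective
      ⟨Fintype.card ι - 1 - m % Fintype.card ι, by omega⟩
    refine ⟨i, m / Fintype.card ι + 1, ?_⟩
    have h1 : (Fintype.equivFin ι i : ℕ) = Fintype.card ι - 1 - m % Fintype.card ι := by rw [hi]
    have h2 := Nat.div_add_mod m (Fintype.card ι)
    have h3 := Nat.mod_lt m hN
    rw [mul_add, mul_one, h1]
    omega
  have hZ : ∀ l, ∀ k j, ¬ Z k j →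
      (B + Matrix.vecMulVec (fun k => B k i) (Pi.single i l)) k j = 0 := fun l k j h => by
    rw [add_vecMulVec_col_apply, hB.1 k j h, mul_zero, ite_self]
  have hd := hB.2.1
  have hpow : (1 : ℝ) ≤ 2 ^ m := one_le_pow₀ one_le_two
  have hd1 : 2 * 2 ^ m ≤ |B.det| := by rwa [pow_succ'] at hd
  have hd0 : B.det ≠ 0 := abs_pos.1 (by linarith)
  have hinv : |B.det⁻¹| ≤ 1 := by
    rw [abs_inv]
    exact inv_le_one_of_one_le₀ (by linarith)
  have hinv1 : B.det⁻¹ ≤ |B.det|⁻¹ := by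
    rw [← abs_inv]
    exact le_abs_self _
  have hinv2 : -B.det⁻¹ ≤ |B.det|⁻¹ := by
    rw [← abs_inv]
    exact neg_le_abs _
  have hinv3 : |B.det|⁻¹ * 2 ≤ 1 := by
    rw [inv_mul_le_iff₀ (by linarith)]
    linarith
  have hnew : B + Matrix.vecMulVec (fun k => B k i) (Pi.single i 1) ∈ stairClass Z ρ (m + 1) := by
    refine ⟨hZ 1, ?_, fun k j => ?_⟩
    · rw [det_add_vecMulVec_col, abs_mul, pow_succ']
      norm_num
      exact hd
    · rw [add_vecMulVec_col_apply]
      have h1 : m + 1 + (Fintype.equivFin ι j : ℕ) = m + Fintype.equivFin ι j + 1 := by omega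
      rw [h1]
      have h2 := hB.2.2 k j
      split_ifs with h
      · subst h
        rw [Nat.succ_div_of_dvd hi, pow_succ, abs_mul]
        norm_num
        linarith
      · exact h2.trans (mul_le_mul_of_nonneg_left (pow_le_pow_right₀ one_le_two
          (Nat.div_le_div_right (Nat.le_succ _))) hρ)
  have hscale : (1 : ℝ) + -(1 - B.det⁻¹) = B.det⁻¹ := by ring
  have hB' := abs_le_of_mem_stairClass hρ hB
  have hP : 0 ≤ ρ * 2 ^ ((m : ℝ) / Fintype.card ι) := by positivity
  refine ⟨fun k => B k i, i, 1, 1 - B.det⁻¹, one_pos, by linarith, hnew, Or.inr ⟨⟨hZ _, ?_⟩, ?_⟩,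
    fun k j => (hB' k j).trans (by linarith), fun k j => ?_, fun k j => ?_⟩
  · rw [det_add_vecMulVec_col, hscale, inv_mul_cancel₀ hd0]
  · have h1 : (1 - B.det⁻¹) / (1 + (1 - B.det⁻¹)) ≤ (1 + |B.det|⁻¹) / (2 + |B.det|⁻¹) := by
      rw [div_le_div_iff₀ (by linarith) (by positivity)]
      nlinarith
    refine h1.trans_lt ?_
    rw [div_lt_div_iff₀ (by positivity) (by positivity)]
    have h2 : |B.det|⁻¹ * 2 ^ m ≤ 1 / 2 := by
      rw [inv_mul_le_iff₀ (by linarith)]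
      linarith
    rw [pow_succ']
    nlinarith
  · rw [add_vecMulVec_col_apply]
    split_ifs
    · rw [abs_mul]
      norm_num
      linarith [hB' k j]
    · exact (hB' k j).trans (by linarith)
  · rw [add_vecMulVec_col_apply, hscale]
    split_ifs
    · rw [abs_mul]
      have := mul_le_mul_of_nonneg_right hinv (abs_nonneg (B k j))
      linarith [hB' k j]
    · exact (hB' k j).trans (by linarith)

end

section

theorem summable_three_div_mul_rpow {N : ℕ} (hN : 2 ≤ N) (C : ℝ) :
    Summable fun j : ℕ => 3 / (2 ^ (j - N) + 2) * (C * 2 ^ (((j - N : ℕ) : ℝ) / N) + 1) := by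
  rw [← summable_nat_add_iff N]
  simp only [Nat.add_sub_cancel]
  have hN0 : (0 : ℝ) < N := by positivity
  have hx : (2 : ℝ) ^ ((1 : ℝ) / N) < 2 := by
    conv_rhs => rw [← Real.rpow_one 2]
    refine Real.rpow_lt_rpow_of_exponent_lt one_lt_two ?_
    rw [div_lt_one hN0]
    exact_mod_cast hN
  have h1 : Summable fun m : ℕ => 3 * |C| * ((2 : ℝ) ^ ((1 : ℝ) / N) / 2) ^ m :=
    (summable_geometric_of_lt_one (by positivity) (by linarith)).mul_left _
  have h2 : Summable fun m : ℕ => 3 * (1 / 2 : ℝ) ^ m := summable_geometric_two.mul_left 3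
  refine Summable.of_norm_bounded (h1.add h2) fun m => ?_
  have h3 : (2 : ℝ) ^ ((m : ℝ) / N) = (2 ^ ((1 : ℝ) / N)) ^ m := by
    rw [← Real.rpow_natCast, ← Real.rpow_mul zero_le_two]
    ring_nf
  rw [h3, div_pow, div_pow, one_pow, norm_mul, Real.norm_of_nonneg (by positivity), Real.norm_eq_abs]
  have h4 : |C * (2 ^ ((1 : ℝ) / N)) ^ m + 1| ≤ |C| * (2 ^ ((1 : ℝ) / N)) ^ m + 1 := by
    refine (abs_add_le _ _).trans (le_of_eq ?_)
    rw [abs_mul, abs_one, abs_of_nonneg (by positivity : (0 : ℝ) ≤ (2 ^ ((1 : ℝ) / N)) ^ m)]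
  calc _ ≤ 3 / 2 ^ m * (|C| * (2 ^ ((1 : ℝ) / N)) ^ m + 1) := by
        gcongr
        linarith
    _ = _ := by ring

theorem tendsto_three_div (N : ℕ) :
    Tendsto (fun j : ℕ => (3 : ℝ) / (2 ^ (j - N) + 2)) atTop (𝓝 0) := by
  refine tendsto_const_nhds.div_atTop (tendsto_atTop_add_const_right _ _ ?_)
  exact (tendsto_pow_atTop_atTop_of_one_lt one_lt_two).comp (tendsto_sub_atTop_nat N)

theorem one_add_rpow_le {x p : ℝ} (hx : 0 ≤ x) (hp : 0 ≤ p) : (1 + x) ^ p ≤ 2 ^ p * (1 + x ^ p) := by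
  rcases le_total x 1 with h | h
  · calc (1 + x) ^ p ≤ 2 ^ p := Real.rpow_le_rpow (by linarith) (by linarith) hp
      _ ≤ _ := le_mul_of_one_le_right (by positivity) (by linarith [Real.rpow_nonneg hx p])
  · calc (1 + x) ^ p ≤ (2 * x) ^ p := Real.rpow_le_rpow (by linarith) (by linarith) hp
      _ = 2 ^ p * x ^ p := Real.mul_rpow zero_le_two hx
      _ ≤ _ := by
        gcongr
        linarith

variable [Fintype ι] [DecidableEq ι]

/-- Matrices with a prescribed support containing a permutation can be reduced to those of
determinant one. -/
theorem reducedTo_det_eq_one (π : ι ≃ ι) {Z : ι → ι → Prop} (hZ : ∀ i, Z (π i) i)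
    (hN : 2 ≤ Fintype.card ι) :
    ReducedTo {X : Matrix ι ι ℝ | ∀ k i, ¬ Z k i → X k i = 0}
      {X | (∀ k i, ¬ Z k i → X k i = 0) ∧ X.det = 1} (Fintype.card ι) := by
  have : Nonempty ι := Fintype.card_pos_iff.1 (by omega)
  set N := Fintype.card ι with hNdef
  have hN1 : (1 : ℝ) ≤ N := by exact_mod_cast (by omega : 1 ≤ N)
  have hNN : (1 : ℝ) ≤ (N * N : ℕ) := by exact_mod_cast (by nlinarith : 1 ≤ N * N)
  have hM : (1 : ℝ) ≤ 3 * (5 * (N * N : ℕ) * (N + 2)) * 2 := by nlinarith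
  refine ⟨_, hM, fun A hA b ε hε α hα s hs Ω hΩ => ?_⟩
  set a := frobNorm A with ha_def
  have ha0 : 0 ≤ a := frobNorm_nonneg A
  have ha : ∀ k i, |A k i| ≤ a := abs_le_frobNorm A
  set t := N * a + 2 with ht
  have ht0 : 0 < t := by positivity
  set ρ := a + t with hρ
  have hρ1 : 1 ≤ ρ := by nlinarith
  have hρa : ρ ≤ (N + 2) * (1 + a) := by nlinarith
  have hrpow : ∀ j : ℕ, (1 : ℝ) ≤ 2 ^ (((j - N : ℕ) : ℝ) / N) := fun j =>
    Real.one_le_rpow one_le_two (by positivity)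
  refine exists_map_of_splits (c := fun j => 3 / (2 ^ (j - N) + 2))
    (q := fun j => (2 ^ (j - N) + 2) / (2 ^ (j + 1 - N) + 2))
    (𝓑 := fun j => if j < N then perturbClass A π t j else stairClass Z ρ (j - N))
    (r := fun j => 4 * ρ * 2 ^ (((j - N : ℕ) : ℝ) / N))
    (R := fun j => 5 * (N * N : ℕ) * ρ * 2 ^ (((j - N : ℕ) : ℝ) / N))
    b hΩ hα (zero_le_one.trans (mem_Ioi.1 hs).le) (by positivity) hε.1 ?_ ?_ (fun j => ?_)
    (fun j => by positivity) (fun j B hB => ?_) (fun j => by positivity) (fun j => ?_)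
    (tendsto_three_div N) (fun j => by positivity) (summable_three_div_mul_rpow hN _)
    (fun j => ?_)
  · rw [if_pos (by omega)]
    exact ⟨fun _ _ _ => rfl, fun i => ⟨fun h => absurd h (Nat.not_lt_zero _), fun _ => rfl⟩⟩
  · rw [Nat.zero_sub]
    norm_num
  · field_simp
  · have h0 := hrpow j
    rcases lt_or_ge j N with h | h
    · rw [if_pos h] at hB
      have h1 : (1 : ℝ) ≤ (2 ^ (j - N) + 2) / (2 ^ (j + 1 - N) + 2) := by
        rw [Nat.sub_eq_zero_of_le h.le, Nat.sub_eq_zero_of_le h, div_self (by norm_num)]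
      refine (splits_of_mem_perturbClass ht0 ha h hB h1 ?_).mono ?_
      · nlinarith
      · rcases (Nat.succ_le_of_lt h).eq_or_lt with h2 | h2
        · have h3 : j + 1 = N := h2
          rw [if_neg (by omega), h3, Nat.sub_self]
          exact perturbClass_card_subset_stairClass hZ hA ha ht ht0.le le_rfl
        · rw [if_pos h2]
    · rw [if_neg (by omega)] at hB ⊢
      rw [show j + 1 - N = j - N + 1 by omega]
      exact splits_of_mem_stairClass (by linarith) hB
  · have h0 := hrpow j
    have h1 : 1 ≤ ρ * 2 ^ (((j - N : ℕ) : ℝ) / N) := one_le_mul_of_one_le_of_one_le hρ1 h0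
    have h2 := mul_le_mul_of_nonneg_left h1 (zero_le_one.trans hNN)
    linarith
  · have h1 : ((2 : ℝ) ^ (((j - N : ℕ) : ℝ) / N)) ^ (N : ℝ) = 2 ^ (j - N) := by
      rw [← Real.rpow_mul zero_le_two, div_mul_cancel₀ _ (by positivity), Real.rpow_natCast]
    rw [Real.mul_rpow (by positivity) (by positivity), h1]
    have h2 : (5 * (N * N : ℕ) * ρ) ^ (N : ℝ) ≤
        (5 * (N * N : ℕ) * (N + 2)) ^ (N : ℝ) * (2 ^ (N : ℝ) * (1 + a ^ (N : ℝ))) := by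
      refine le_trans ?_ (mul_le_mul_of_nonneg_left (one_add_rpow_le ha0 (by positivity))
        (by positivity))
      rw [← Real.mul_rpow (by positivity) (by positivity), mul_assoc _ _ (1 + a)]
      gcongr
    have h3 : (3 : ℝ) ≤ 3 ^ (N : ℝ) := by
      conv_lhs => rw [← Real.rpow_one 3]
      exact Real.rpow_le_rpow_of_exponent_le (by norm_num) hN1
    have h5 : (3 * (5 * (N * N : ℕ) * (N + 2)) * 2 : ℝ) ^ (N : ℝ) =
        3 ^ (N : ℝ) * (5 * (N * N : ℕ) * (N + 2)) ^ (N : ℝ) * 2 ^ (N : ℝ) := by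
      rw [Real.mul_rpow (by positivity) zero_le_two, Real.mul_rpow (by norm_num) (by positivity)]
    rw [h5]
    have h4 : 3 / (2 ^ (j - N) + 2) * (2 : ℝ) ^ (j - N) ≤ 3 := by
      rw [div_mul_eq_mul_div, div_le_iff₀ (by positivity)]
      linarith
    calc _ = (5 * (N * N : ℕ) * ρ) ^ (N : ℝ) * (3 / (2 ^ (j - N) + 2) * (2 : ℝ) ^ (j - N)) := by
          ring
      _ ≤ (5 * (N * N : ℕ) * (N + 2)) ^ (N : ℝ) * (2 ^ (N : ℝ) * (1 + a ^ (N : ℝ))) *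
          3 ^ (N : ℝ) := by
          gcongr
          exact h4.trans h3
      _ = _ := by ring

theorem reducedTo_L1set {n : ℕ} (hn : 0 < n) :
    ReducedTo (L1set n) (L1set n ∩ SigmaSet n) (2 * n : ℝ) := by
  have hcard : Fintype.card (Fin n ⊕ Fin n) = 2 * n := by simp; omega
  have h := reducedTo_det_eq_one (Equiv.refl (Fin n ⊕ Fin n))
    (Z := fun k i => k.isLeft = i.isLeft) (fun _ => rfl) (by omega)
  have h1 : {X : Matrix (Fin n ⊕ Fin n) (Fin n ⊕ Fin n) ℝ |
      ∀ k i, ¬ k.isLeft = i.isLeft → X k i = 0} = L1set n := by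
    ext X
    simp [L1set]
  have h2 : {X : Matrix (Fin n ⊕ Fin n) (Fin n ⊕ Fin n) ℝ |
      (∀ k i, ¬ k.isLeft = i.isLeft → X k i = 0) ∧ X.det = 1} = L1set n ∩ SigmaSet n := by
    rw [← h1]
    rfl
  rw [h1, h2, hcard] at h
  exact_mod_cast h

theorem reducedTo_L2set {n : ℕ} (hn : 0 < n) :
    ReducedTo (L2set n) (L2set n ∩ SigmaSet n) (2 * n : ℝ) := by
  have hcard : Fintype.card (Fin n ⊕ Fin n) = 2 * n := by simp; omega
  have h := reducedTo_det_eq_one (Equiv.sumComm (Fin n) (Fin n))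
    (Z := fun k i => k.isLeft = i.isRight) (fun i => by cases i <;> rfl) (by omega)
  have h1 : {X : Matrix (Fin n ⊕ Fin n) (Fin n ⊕ Fin n) ℝ |
      ∀ k i, ¬ k.isLeft = i.isRight → X k i = 0} = L2set n := by
    ext X
    simp [L2set]
  have h2 : {X : Matrix (Fin n ⊕ Fin n) (Fin n ⊕ Fin n) ℝ |
      (∀ k i, ¬ k.isLeft = i.isRight → X k i = 0) ∧ X.det = 1} = L2set n ∩ SigmaSet n := by
    rw [← h1]
    rfl
  rw [h1, h2, hcard] at h
  exact_mod_cast h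

end

/-- Proposition (Stage 3): `L₁` can be reduced to `L₁ ∩ Σ`, and `L₂` to `L₂ ∩ Σ`,
in weak `L^{2n}`. -/
theorem stage3_reduction (n : ℕ) (hn : 0 < n) :
    ReducedTo (L1set n) (L1set n ∩ SigmaSet n) (2 * n : ℝ) ∧
    ReducedTo (L2set n) (L2set n ∩ SigmaSet n) (2 * n : ℝ) := by
  exact ⟨reducedTo_L1set hn, reducedTo_L2set hn⟩

end Paper
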